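/- Let $X$ be a Banach space, $s>0$, $p\in(1,\infty)$, $\gamma\in(-1,p-1)$, $q\in[1,\infty]$, and let $m,n$ be integers with $m,n>s$. Then the difference seminorms $[f]^{(m)}_{F^s_{p,q}(I,w_\gamma;X)}$ and $[f]^{(n)}_{F^s_{p,q}(I,w_\gamma;X)}$ are equivalent on $F^s_{p,q}(I,w_\gamma;X)$, for $I\in\{\mathbb{R},(0,\infty)\}$. -/

import Mathlib

open MeasureTheory Set ENNReal

noncomputable section

variable {X : Type*} [NormedAddCommGroup X] [NormedSpace ℝ X]

/-- The `m`-th order difference `Δ^m_h f(x) = ∑_{j=0}^m (-1)^j binom(m,j) f(x+(m-j)h)`. -/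
def mDiff (m : ℕ) (h : ℝ) (f : ℝ → X) (x : ℝ) : X :=
  ∑ j ∈ Finset.range (m + 1), ((-1 : ℝ) ^ j * (m.choose j)) • f (x + ((m : ℝ) - j) * h)

/-- Mean of the `m`-th order difference,
`d^m_t f(x) = t⁻¹ ∫_{V^m_I(x,t)} ‖Δ^m_h f(x)‖ dh`, `V^m_I(x,t) = {|h|<t : x+mh ∈ I}`. -/
def dMean (I : Set ℝ) (m : ℕ) (t : ℝ) (f : ℝ → X) (x : ℝ) : ℝ≥0∞ :=
  ENNReal.ofReal t⁻¹ *
    ∫⁻ h in {h : ℝ | |h| < t ∧ x + (m : ℝ) * h ∈ I}, (‖mDiff m h f x‖₊ : ℝ≥0∞)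

/-- The inner `L^q(dt/t)` norm `(∫_0^∞ (t^{-s} d^m_t f(x))^q dt/t)^{1/q}` (sup if `q=∞`). -/
def innerQ (I : Set ℝ) (s : ℝ) (q : ℝ≥0∞) (m : ℕ) (f : ℝ → X) (x : ℝ) : ℝ≥0∞ :=
  if q = ⊤ then ⨆ (t : ℝ) (_ : 0 < t), ENNReal.ofReal (t ^ (-s)) * dMean I m t f x
  else (∫⁻ t in Ioi (0:ℝ),
      (ENNReal.ofReal (t ^ (-s)) * dMean I m t f x) ^ q.toReal *
        (ENNReal.ofReal t)⁻¹) ^ (1 / q.toReal)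

/-- The difference seminorm `[f]^{(m)}_{F^s_{p,q}(I, w_γ; X)}`, `w_γ(t) = |t|^γ`. -/
def diffSeminorm (I : Set ℝ) (s p γ : ℝ) (q : ℝ≥0∞) (m : ℕ) (f : ℝ → X) : ℝ≥0∞ :=
  (∫⁻ x in I, ENNReal.ofReal (|x| ^ γ) * (innerQ I s q m f x) ^ p) ^ (1 / p)

/-- The weighted `L^p(I, w_γ; X)` norm, `w_γ(t) = |t|^γ`. -/
def wLpNorm (I : Set ℝ) (p γ : ℝ) (f : ℝ → X) : ℝ≥0∞ :=
  (∫⁻ x in I, ENNReal.ofReal (|x| ^ γ) * (‖f x‖₊ : ℝ≥0∞) ^ p) ^ (1 / p)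


/-! ### Power weights -/

def wt (γ : ℝ) (x : ℝ) : ℝ≥0∞ := ENNReal.ofReal (|x| ^ γ)

def wm (γ : ℝ) : Measure ℝ := volume.withDensity (wt γ)

theorem wt_meas (γ : ℝ) : Measurable (wt γ) := by
  unfold wt; fun_prop

theorem wt_lt_top (γ x : ℝ) : wt γ x < ⊤ := ENNReal.ofReal_lt_top

theorem wt_pos (γ : ℝ) {x : ℝ} (hx : x ≠ 0) : wt γ x ≠ 0 := by
  unfold wt
  have := Real.rpow_pos_of_pos (abs_pos.2 hx) γ
  simpa using this

theorem lint_wm (γ : ℝ) (g : ℝ → ℝ≥0∞) : ∫⁻ x, g x ∂(wm γ) = ∫⁻ x, wt γ x * g x := by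
  unfold wm
  rw [lintegral_withDensity_eq_lintegral_mul_non_measurable _ (wt_meas γ)
    (Filter.Eventually.of_forall fun x => wt_lt_top γ x)]
  rfl

theorem setLint_wm (γ : ℝ) (g : ℝ → ℝ≥0∞) {s : Set ℝ} (hs : MeasurableSet s) :
    ∫⁻ x in s, g x ∂(wm γ) = ∫⁻ x in s, wt γ x * g x := by
  unfold wm
  rw [setLIntegral_withDensity_eq_setLIntegral_mul_non_measurable _ (wt_meas γ) _ hs
    (Filter.Eventually.of_forall fun x => wt_lt_top γ x)]
  rfl

theorem wm_apply (γ : ℝ) {s : Set ℝ} (hs : MeasurableSet s) :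
    wm γ s = ∫⁻ x in s, wt γ x := by
  unfold wm
  rw [withDensity_apply _ hs]

theorem lint_rpow (b : ℝ) (hb : 0 < b) (a : ℝ) (ha : 0 ≤ a) :
    ∫⁻ x in Ioc 0 a, ENNReal.ofReal (x ^ (b - 1)) = ENNReal.ofReal (a ^ b / b) := by
  have h1 : IntervalIntegrable (fun x : ℝ => x ^ (b - 1)) volume 0 a :=
    intervalIntegral.intervalIntegrable_rpow' (by linarith)
  rw [intervalIntegrable_iff_integrableOn_Ioc_of_le ha] at h1
  rw [← ofReal_integral_eq_lintegral_ofReal h1]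
  · rw [← intervalIntegral.integral_of_le ha, integral_rpow (Or.inl (by linarith))]
    congr 1
    have : b - 1 + 1 = b := by ring
    rw [this, Real.zero_rpow hb.ne', sub_zero]
  · refine (ae_restrict_iff' measurableSet_Ioc).2 (Filter.Eventually.of_forall fun x hx => ?_)
    exact Real.rpow_nonneg hx.1.le _

theorem wm_symm_le (γ : ℝ) (hγ : -1 < γ) (a : ℝ) (ha : 0 ≤ a) :
    wm γ (Icc (-a) a) ≤ 2 * ENNReal.ofReal (a ^ (γ + 1) / (γ + 1)) := by
  rw [wm_apply γ measurableSet_Icc]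
  have hpos : ∫⁻ x in Icc 0 a, wt γ x = ENNReal.ofReal (a ^ (γ + 1) / (γ + 1)) := by
    rw [← lint_rpow (γ + 1) (by linarith) a ha, setLIntegral_congr Ioc_ae_eq_Icc.symm]
    refine setLIntegral_congr_fun measurableSet_Ioc fun x hx => ?_
    simp only [wt, abs_of_pos hx.1]; congr 2; ring
  have hneg : ∫⁻ x in Icc (-a) 0, wt γ x = ∫⁻ x in Icc 0 a, wt γ x := by
    have hm := (Measure.measurePreserving_neg (volume : Measure ℝ))
    rw [← hm.setLIntegral_comp_preimage measurableSet_Icc (wt_meas γ)]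
    simp [wt]
  calc ∫⁻ x in Icc (-a) a, wt γ x ≤ ∫⁻ x in Icc (-a) 0 ∪ Icc 0 a, wt γ x := by
        apply lintegral_mono_set
        intro x hx
        rcases le_total x 0 with h | h
        · exact Or.inl ⟨hx.1, h⟩
        · exact Or.inr ⟨h, hx.2⟩
    _ ≤ _ := lintegral_union_le _ _ _
    _ = _ := by rw [hneg, hpos, two_mul]

theorem wm_ball_upper (γ : ℝ) (hγ : -1 < γ) : ∃ C : ℝ, 0 < C ∧ ∀ x r : ℝ, 0 < r →
    wm γ (Metric.closedBall x r) ≤ ENNReal.ofReal (C * (r * (|x| + r) ^ γ)) := by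
  have key : ∀ (D : ℝ) (x r : ℝ), 0 < r → 0 ≤ D →
      (∀ y ∈ Metric.closedBall x r, |y| ^ γ ≤ D) →
      wm γ (Metric.closedBall x r) ≤ ENNReal.ofReal (2 * r * D) := by
    intro D x r hr hD h
    rw [wm_apply γ Metric.isClosed_closedBall.measurableSet]
    calc ∫⁻ y in Metric.closedBall x r, wt γ y ≤ ∫⁻ y in Metric.closedBall x r, ENNReal.ofReal D :=
          setLIntegral_mono measurable_const fun y hy => ENNReal.ofReal_le_ofReal (h y hy)
      _ = _ := by
          rw [setLIntegral_const, Real.volume_closedBall, ← ENNReal.ofReal_mul hD]; ring_nf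
  rcases le_or_gt 0 γ with h0 | h0
  · refine ⟨2, by norm_num, fun x r hr => ?_⟩
    refine (key ((|x| + r) ^ γ) x r hr (by positivity) fun y hy => ?_).trans (by rw [mul_assoc])
    apply Real.rpow_le_rpow (abs_nonneg _) _ h0
    rw [Metric.mem_closedBall, Real.dist_eq] at hy
    have := abs_sub_abs_le_abs_sub y x
    linarith
  · refine ⟨max (2 * 3 ^ (-γ)) (6 / (γ + 1)), by positivity, fun x r hr => ?_⟩
    rcases le_or_gt (2 * r) |x| with h | h
    · refine (key (3 ^ (-γ) * (|x| + r) ^ γ) x r hr (by positivity) fun y hy => ?_).trans ?_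
      · rw [Metric.mem_closedBall, Real.dist_eq] at hy
        have h1 := abs_sub_abs_le_abs_sub x y
        rw [abs_sub_comm] at h1
        have h2 : (|x| + r) / 3 ≤ |y| := by linarith
        calc |y| ^ γ ≤ ((|x| + r) / 3) ^ γ :=
              Real.rpow_le_rpow_of_nonpos (by positivity) h2 h0.le
          _ = _ := by
              rw [Real.div_rpow (by positivity) (by norm_num), Real.rpow_neg (by norm_num)]
              field_simp
      · apply ENNReal.ofReal_le_ofReal
        calc 2 * r * (3 ^ (-γ) * (|x| + r) ^ γ) = (2 * 3 ^ (-γ)) * (r * (|x| + r) ^ γ) := by ring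
          _ ≤ _ := by gcongr; exact le_max_left _ _
    · have hsub : Metric.closedBall x r ⊆ Icc (-(3 * r)) (3 * r) := by
        intro y hy
        rw [Metric.mem_closedBall, Real.dist_eq] at hy
        have h1 := abs_sub_abs_le_abs_sub y x
        exact abs_le.1 (by linarith)
      refine (measure_mono hsub).trans ((wm_symm_le γ hγ _ (by positivity)).trans ?_)
      rw [show (2 : ℝ≥0∞) = ENNReal.ofReal 2 by simp, ← ENNReal.ofReal_mul (by norm_num)]
      apply ENNReal.ofReal_le_ofReal
      have h3 : (3 * r) ^ γ ≤ (|x| + r) ^ γ :=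
        Real.rpow_le_rpow_of_nonpos (by positivity) (by linarith) h0.le
      have hg : 0 < γ + 1 := by linarith
      calc 2 * ((3 * r) ^ (γ + 1) / (γ + 1)) = 6 / (γ + 1) * (r * (3 * r) ^ γ) := by
            rw [Real.rpow_add_one (by positivity)]; ring
        _ ≤ 6 / (γ + 1) * (r * (|x| + r) ^ γ) := by gcongr
        _ ≤ _ := by gcongr; exact le_max_right _ _

theorem wm_ball_lower (γ : ℝ) : ∃ c : ℝ, 0 < c ∧ ∀ x r : ℝ, 0 < r →
    ENNReal.ofReal (c * (r * (|x| + r) ^ γ)) ≤ wm γ (Metric.closedBall x r) := by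
  have key : ∀ (D : ℝ) (x r a : ℝ), 0 < r → 0 ≤ D → Icc a (a + r / 2) ⊆ Metric.closedBall x r →
      (∀ y ∈ Icc a (a + r / 2), D ≤ |y| ^ γ) →
      ENNReal.ofReal (r / 2 * D) ≤ wm γ (Metric.closedBall x r) := by
    intro D x r a hr hD hs h
    refine le_trans ?_ (measure_mono hs)
    rw [wm_apply γ measurableSet_Icc]
    calc ENNReal.ofReal (r / 2 * D) = ∫⁻ y in Icc a (a + r / 2), ENNReal.ofReal D := by
          rw [setLIntegral_const, Real.volume_Icc, ← ENNReal.ofReal_mul hD]; ring_nf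
      _ ≤ _ :=
          setLIntegral_mono (wt_meas γ) fun y hy => ENNReal.ofReal_le_ofReal (h y hy)
  refine ⟨min (1/2) (1 / 2 * (1 / 2) ^ γ), by positivity, fun x r hr => ?_⟩
  -- choose subinterval far from zero
  obtain ⟨a, ha1, ha2⟩ : ∃ a : ℝ, Icc a (a + r / 2) ⊆ Metric.closedBall x r ∧
      ∀ y ∈ Icc a (a + r / 2), (|x| + r) / 2 ≤ |y| := by
    rcases le_total 0 x with hx | hx
    · refine ⟨x + r / 2, fun y hy => ?_, fun y hy => ?_⟩
      · rw [Metric.mem_closedBall, Real.dist_eq, abs_le]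
        constructor <;> linarith [hy.1, hy.2]
      · rw [abs_of_nonneg hx, le_abs]; left; linarith [hy.1]
    · refine ⟨x - r, fun y hy => ?_, fun y hy => ?_⟩
      · rw [Metric.mem_closedBall, Real.dist_eq, abs_le]
        constructor <;> linarith [hy.1, hy.2]
      · rw [abs_of_nonpos hx, le_abs]; right; linarith [hy.2]
  have hxr : 0 < |x| + r := by positivity
  rcases le_or_gt 0 γ with h0 | h0
  · refine le_trans (ENNReal.ofReal_le_ofReal ?_) (key (((|x| + r) / 2) ^ γ) x r a hr
      (by positivity) ha1 fun y hy => ?_)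
    · calc _ ≤ (1 / 2 * (1 / 2) ^ γ) * (r * (|x| + r) ^ γ) := by
            gcongr; exact min_le_right _ _
        _ = _ := by
            rw [div_eq_mul_one_div (|x| + r) 2, Real.mul_rpow hxr.le (by norm_num)]; ring
    · exact Real.rpow_le_rpow (by positivity) (ha2 y hy) h0
  · refine le_trans (ENNReal.ofReal_le_ofReal ?_) (key ((|x| + r) ^ γ) x r a hr
      (by positivity) ha1 fun y hy => ?_)
    · calc _ ≤ (1 / 2) * (r * (|x| + r) ^ γ) := by
            gcongr; exact min_le_left _ _
        _ = _ := by ring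
    · have h1 := ha1 hy
      rw [Metric.mem_closedBall, Real.dist_eq] at h1
      have h2 := abs_sub_abs_le_abs_sub y x
      exact Real.rpow_le_rpow_of_nonpos (lt_of_lt_of_le (by positivity) (ha2 y hy))
        (by linarith) h0.le

theorem wm_ball_pos (γ x r : ℝ) (hr : 0 < r) : wm γ (Metric.closedBall x r) ≠ 0 := by
  obtain ⟨c, hc, h⟩ := wm_ball_lower γ
  refine (lt_of_lt_of_le ?_ (h x r hr)).ne'
  rw [ENNReal.ofReal_pos]
  have : 0 < |x| + r := by positivity
  positivity

theorem wm_ball_top (γ : ℝ) (hγ : -1 < γ) (x r : ℝ) (hr : 0 < r) :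
    wm γ (Metric.closedBall x r) ≠ ⊤ := by
  obtain ⟨c, hc, h⟩ := wm_ball_upper γ hγ
  exact ((h x r hr).trans_lt ENNReal.ofReal_lt_top).ne

theorem wm_doubling (γ : ℝ) (hγ : -1 < γ) : ∃ D : ℝ≥0∞, D ≠ ⊤ ∧ ∀ x r : ℝ, 0 < r →
    wm γ (Metric.closedBall x (4 * r)) ≤ D * wm γ (Metric.closedBall x r) := by
  obtain ⟨c, hc, h⟩ := wm_ball_lower γ
  obtain ⟨C, hC, H⟩ := wm_ball_upper γ hγ
  refine ⟨ENNReal.ofReal (C * 4 * max 1 (4 ^ γ) / c), ENNReal.ofReal_ne_top, fun x r hr => ?_⟩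
  have hxr : 0 < |x| + r := by positivity
  have h4 : (|x| + 4 * r) ^ γ ≤ max 1 (4 ^ γ) * (|x| + r) ^ γ := by
    rcases le_or_gt 0 γ with h0 | h0
    · calc (|x| + 4 * r) ^ γ ≤ (4 * (|x| + r)) ^ γ := by
            apply Real.rpow_le_rpow (by positivity) _ h0
            have := abs_nonneg x; linarith
        _ = 4 ^ γ * (|x| + r) ^ γ := Real.mul_rpow (by norm_num) hxr.le
        _ ≤ _ := by gcongr; exact le_max_right _ _
    · calc (|x| + 4 * r) ^ γ ≤ 1 * (|x| + r) ^ γ := by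
            rw [one_mul]
            exact Real.rpow_le_rpow_of_nonpos hxr (by linarith) h0.le
        _ ≤ _ := by gcongr; exact le_max_left _ _
  calc _ ≤ ENNReal.ofReal (C * (4 * r * (|x| + 4 * r) ^ γ)) := H x (4 * r) (by positivity)
    _ ≤ ENNReal.ofReal (C * (4 * r * (max 1 (4 ^ γ) * (|x| + r) ^ γ))) := by
        apply ENNReal.ofReal_le_ofReal; gcongr
    _ = ENNReal.ofReal (C * 4 * max 1 (4 ^ γ) / c) * ENNReal.ofReal (c * (r * (|x| + r) ^ γ)) := by
        rw [← ENNReal.ofReal_mul (by positivity)]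
        congr 1; field_simp
    _ ≤ _ := by gcongr; exact h x r hr



/-! ### Maximal function -/

theorem ballInt_meas (μ : Measure ℝ) [SFinite μ] {h : ℝ → ℝ≥0∞} (hh : Measurable h) (r : ℝ) :
    Measurable fun x => ∫⁻ y in Metric.closedBall x r, h y ∂μ := by
  have h1 : ∀ x, ∫⁻ y in Metric.closedBall x r, h y ∂μ =
      ∫⁻ y, ({p : ℝ × ℝ | dist p.2 p.1 ≤ r}.indicator (fun p => h p.2)) (x, y) ∂μ := by
    intro x
    rw [← lintegral_indicator Metric.isClosed_closedBall.measurableSet]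
    rfl
  simp_rw [h1]
  apply Measurable.lintegral_prod_right'
  apply Measurable.indicator (by fun_prop)
  exact measurableSet_le (by fun_prop) measurable_const

def mxm (μ : Measure ℝ) (h : ℝ → ℝ≥0∞) (x : ℝ) : ℝ≥0∞ :=
  ⨆ k : ℤ, (μ (Metric.closedBall x ((2 : ℝ) ^ k)))⁻¹ *
    ∫⁻ y in Metric.closedBall x ((2 : ℝ) ^ k), h y ∂μ

theorem mxm_meas (μ : Measure ℝ) [SFinite μ] {h : ℝ → ℝ≥0∞} (hh : Measurable h) :
    Measurable (mxm μ h) := by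
  refine Measurable.iSup fun k => Measurable.mul (Measurable.inv ?_) (ballInt_meas μ hh _)
  have := ballInt_meas μ (measurable_const (a := (1 : ℝ≥0∞))) ((2 : ℝ) ^ k)
  simpa using this

theorem mxm_weak (μ : Measure ℝ) (D : ℝ≥0∞)
    (hD : ∀ x r : ℝ, 0 < r →
      μ (Metric.closedBall x (4 * r)) ≤ D * μ (Metric.closedBall x r))
    (h0 : ∀ x r : ℝ, 0 < r → μ (Metric.closedBall x r) ≠ 0)
    (h1 : ∀ x r : ℝ, 0 < r → μ (Metric.closedBall x r) ≠ ⊤)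
    (h : ℝ → ℝ≥0∞) (l : ℝ≥0∞) (hl0 : l ≠ 0) (hl1 : l ≠ ⊤) :
    μ {x | l < mxm μ h x} ≤ D * l⁻¹ * ∫⁻ x, h x ∂μ := by
  let T : ℕ → Set ℝ := fun K => {x | ∃ k : ℤ, k ≤ K ∧
    l * μ (Metric.closedBall x ((2 : ℝ) ^ k)) < ∫⁻ y in Metric.closedBall x ((2 : ℝ) ^ k), h y ∂μ}
  have hT : {x | l < mxm μ h x} ⊆ ⋃ K, T K := by
    intro x hx
    simp only [mem_ofPred_eq, mxm, lt_iSup_iff] at hx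
    obtain ⟨k, hk⟩ := hx
    refine mem_iUnion.2 ⟨k.toNat, k, Int.self_le_toNat k, ?_⟩
    rw [mul_comm, ← div_eq_mul_inv] at hk
    have hp : (0 : ℝ) < 2 ^ k := by positivity
    exact (ENNReal.lt_div_iff_mul_lt (Or.inl (h0 _ _ hp)) (Or.inl (h1 _ _ hp))).1 hk
  have hmono : Monotone T := by
    intro K K' hKK x ⟨k, hk, hx⟩
    exact ⟨k, hk.trans (by exact_mod_cast hKK), hx⟩
  refine (measure_mono hT).trans ?_
  rw [hmono.measure_iUnion]
  refine iSup_le fun K => ?_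
  let t : Set (ℝ × ℤ) := {b | b.2 ≤ K ∧ l * μ (Metric.closedBall b.1 ((2 : ℝ) ^ b.2)) <
    ∫⁻ y in Metric.closedBall b.1 ((2 : ℝ) ^ b.2), h y ∂μ}
  obtain ⟨u, hut, hdis, hcov⟩ := Vitali.exists_disjoint_subfamily_covering_enlargement_closedBall
    t (fun b => b.1) (fun b => (2 : ℝ) ^ b.2) ((2 : ℝ) ^ (K : ℤ))
    (fun b hb => zpow_le_zpow_right₀ (by norm_num) hb.1) 4 (by norm_num)
  have hc : u.Countable := hdis.countable_of_nonempty_interior fun b _ => by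
    have : (Metric.ball b.1 ((2 : ℝ) ^ b.2)).Nonempty := Metric.nonempty_ball.2 (by positivity)
    exact this.mono Metric.ball_subset_interior_closedBall
  have hsub : T K ⊆ ⋃ b ∈ u, Metric.closedBall b.1 (4 * (2 : ℝ) ^ b.2) := by
    rintro x ⟨k, hk, hx⟩
    obtain ⟨b, hb, hb'⟩ := hcov (x, k) ⟨hk, hx⟩
    refine mem_iUnion₂.2 ⟨b, hb, hb' ?_⟩
    exact Metric.mem_closedBall_self (by positivity)
  calc μ (T K) ≤ μ (⋃ b ∈ u, Metric.closedBall b.1 (4 * (2 : ℝ) ^ b.2)) := measure_mono hsub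
    _ ≤ ∑' b : u, μ (Metric.closedBall b.1.1 (4 * (2 : ℝ) ^ b.1.2)) := measure_biUnion_le _ hc _
    _ ≤ ∑' b : u, D * l⁻¹ * ∫⁻ y in Metric.closedBall b.1.1 ((2 : ℝ) ^ b.1.2), h y ∂μ := by
        refine ENNReal.tsum_le_tsum fun b => ?_
        refine (hD _ _ (by positivity)).trans ?_
        rw [mul_assoc]
        gcongr
        rw [mul_comm, ← div_eq_mul_inv, ENNReal.le_div_iff_mul_le (Or.inl hl0) (Or.inl hl1),
          mul_comm]
        exact (hut b.2).2.le
    _ = D * l⁻¹ * ∫⁻ y in ⋃ b ∈ u, Metric.closedBall b.1 ((2 : ℝ) ^ b.2), h y ∂μ := by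
        rw [ENNReal.tsum_mul_left, lintegral_biUnion hc
          (fun b _ => Metric.isClosed_closedBall.measurableSet) hdis]
    _ ≤ _ := by
        gcongr
        exact Measure.restrict_le_self

theorem layer_le (b : ℝ) (hb : 0 < b) (y : ℝ≥0∞) :
    y ^ b ≤ ENNReal.ofReal b * ∫⁻ l in Ioi (0 : ℝ),
      {l : ℝ | ENNReal.ofReal l < y}.indicator (fun l => ENNReal.ofReal (l ^ (b - 1))) l := by
  have fin : ∀ a : ℝ, 0 ≤ a → ENNReal.ofReal a ≤ y → ENNReal.ofReal (a ^ b) ≤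
      ENNReal.ofReal b * ∫⁻ l in Ioi (0 : ℝ),
      {l : ℝ | ENNReal.ofReal l < y}.indicator (fun l => ENNReal.ofReal (l ^ (b - 1))) l := by
    intro a ha hy
    calc ENNReal.ofReal (a ^ b) = ENNReal.ofReal b * ENNReal.ofReal (a ^ b / b) := by
          rw [← ENNReal.ofReal_mul hb.le]; congr 1; field_simp
      _ = ENNReal.ofReal b * ∫⁻ x in Ioo 0 a, ENNReal.ofReal (x ^ (b - 1)) := by
          rw [← lint_rpow b hb a ha, setLIntegral_congr Ioo_ae_eq_Ioc]
      _ = ENNReal.ofReal b * ∫⁻ l in Ioo (0 : ℝ) a,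
      {l : ℝ | ENNReal.ofReal l < y}.indicator (fun l => ENNReal.ofReal (l ^ (b - 1))) l := by
          congr 1
          refine setLIntegral_congr_fun measurableSet_Ioo fun x hx => ?_
          rw [indicator_of_mem]
          refine lt_of_lt_of_le ?_ hy
          exact (ENNReal.ofReal_lt_ofReal_iff (hx.1.trans hx.2)).2 hx.2
      _ ≤ _ := by
          gcongr
          exact Ioo_subset_Ioi_self
  rcases eq_or_ne y ⊤ with rfl | hy
  · rw [ENNReal.top_rpow_of_pos hb]
    refine le_of_forall_lt fun c hc => ?_
    have h2 := fin ((c.toReal + 1) ^ (1 / b)) (by positivity) le_top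
    refine lt_of_lt_of_le ?_ h2
    rw [← Real.rpow_mul (by positivity), one_div_mul_cancel hb.ne', Real.rpow_one]
    rw [ENNReal.lt_ofReal_iff_toReal_lt hc.ne]; linarith
  · have := fin y.toReal ENNReal.toReal_nonneg (by rw [ENNReal.ofReal_toReal hy])
    rwa [← ENNReal.ofReal_rpow_of_nonneg ENNReal.toReal_nonneg hb.le, ENNReal.ofReal_toReal hy]
      at this

theorem layer_ge (b : ℝ) (hb : 0 < b) (y : ℝ≥0∞) :
    ∫⁻ l in Ioi (0 : ℝ),
      {l : ℝ | ENNReal.ofReal l < y}.indicator (fun l => ENNReal.ofReal (l ^ (b - 1))) l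
      ≤ ENNReal.ofReal b⁻¹ * y ^ b := by
  rcases eq_or_ne y ⊤ with rfl | hy
  · rw [ENNReal.top_rpow_of_pos hb, ENNReal.mul_top (by simpa using hb)]; exact le_top
  · calc _ ≤ ∫⁻ l in Ioi (0 : ℝ), (Ioc 0 y.toReal).indicator
          (fun l => ENNReal.ofReal (l ^ (b - 1))) l := by
          refine setLIntegral_mono' measurableSet_Ioi fun l hl => ?_
          by_cases h : ENNReal.ofReal l < y
          · rw [indicator_of_mem (by exact h), indicator_of_mem]
            exact ⟨hl, ((ENNReal.ofReal_lt_iff_lt_toReal (le_of_lt hl) hy).1 h).le⟩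
          · rw [indicator_of_notMem (by exact h)]; exact zero_le
        _ ≤ ∫⁻ l, (Ioc 0 y.toReal).indicator (fun l => ENNReal.ofReal (l ^ (b - 1))) l :=
          setLIntegral_le_lintegral _ _
        _ = ENNReal.ofReal b⁻¹ * y ^ b := by
          rw [lintegral_indicator measurableSet_Ioc, lint_rpow b hb _ ENNReal.toReal_nonneg,
            div_eq_inv_mul, ENNReal.ofReal_mul (by positivity),
            ← ENNReal.ofReal_rpow_of_nonneg ENNReal.toReal_nonneg hb.le, ENNReal.ofReal_toReal hy]

theorem mxm_trunc (μ : Measure ℝ)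
    {h : ℝ → ℝ≥0∞} (l : ℝ≥0∞) (x : ℝ) :
    mxm μ h x ≤ mxm μ ({y | l < 2 * h y}.indicator h) x + l / 2 := by
  refine iSup_le fun k => ?_
  have hp : (0 : ℝ) < 2 ^ k := by positivity
  calc (μ (Metric.closedBall x ((2 : ℝ) ^ k)))⁻¹ *
      ∫⁻ y in Metric.closedBall x ((2 : ℝ) ^ k), h y ∂μ
      ≤ (μ (Metric.closedBall x ((2 : ℝ) ^ k)))⁻¹ *
      ∫⁻ y in Metric.closedBall x ((2 : ℝ) ^ k), ({y | l < 2 * h y}.indicator h y + l / 2) ∂μ := by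
        gcongr with y
        by_cases hy : l < 2 * h y
        · rw [indicator_of_mem (by exact hy)]; exact le_self_add
        · refine le_add_left ?_
          rw [not_lt] at hy
          rw [ENNReal.le_div_iff_mul_le (by simp) (by simp), mul_comm]; exact hy
    _ ≤ _ := by
        rw [lintegral_add_right _ measurable_const, mul_add, setLIntegral_const]
        gcongr
        · exact le_iSup (fun k : ℤ => (μ (Metric.closedBall x ((2 : ℝ) ^ k)))⁻¹ *
            ∫⁻ y in Metric.closedBall x ((2 : ℝ) ^ k), ({y | l < 2 * h y}.indicator h y) ∂μ) k
        · rw [mul_left_comm]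
          calc _ ≤ l / 2 * 1 := by gcongr; exact ENNReal.inv_mul_le_one _
            _ = _ := mul_one _

theorem mxm_strong (μ : Measure ℝ) [SFinite μ] (D : ℝ≥0∞) (hDt : D ≠ ⊤)
    (hD : ∀ x r : ℝ, 0 < r →
      μ (Metric.closedBall x (4 * r)) ≤ D * μ (Metric.closedBall x r))
    (h0 : ∀ x r : ℝ, 0 < r → μ (Metric.closedBall x r) ≠ 0)
    (h1 : ∀ x r : ℝ, 0 < r → μ (Metric.closedBall x r) ≠ ⊤)
    (a : ℝ) (ha : 1 < a) : ∃ C : ℝ≥0∞, C ≠ ⊤ ∧ ∀ h : ℝ → ℝ≥0∞, Measurable h →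
    ∫⁻ x, mxm μ h x ^ a ∂μ ≤ C * ∫⁻ x, h x ^ a ∂μ := by
  refine ⟨ENNReal.ofReal a * (D * 2) * (ENNReal.ofReal (a - 1)⁻¹ * 2 ^ (a - 1)), ?_,
    fun h hh => ?_⟩
  · refine ENNReal.mul_ne_top (by finiteness) (ENNReal.mul_ne_top (by finiteness) ?_)
    exact ENNReal.rpow_ne_top_of_nonneg (by linarith) (by simp)
  have wk : ∀ l : ℝ, 0 < l → μ {x | ENNReal.ofReal l < mxm μ h x} ≤
      D * 2 * ((ENNReal.ofReal l)⁻¹ *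
        ∫⁻ x, {y | ENNReal.ofReal l < 2 * h y}.indicator h x ∂μ) := by
    intro l hl
    have hl2 : ENNReal.ofReal l / 2 ≠ 0 := by
      simp [hl]
    have hl3 : ENNReal.ofReal l / 2 ≠ ⊤ := by finiteness
    have := mxm_weak μ D hD h0 h1 ({y | ENNReal.ofReal l < 2 * h y}.indicator h) _ hl2 hl3
    refine (measure_mono ?_).trans (this.trans (le_of_eq ?_))
    · intro x hx
      simp only [mem_ofPred_eq] at hx ⊢
      by_contra hcon
      rw [not_lt] at hcon
      have h2 := mxm_trunc μ (h := h) (ENNReal.ofReal l) x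
      have h3 : mxm μ h x ≤ ENNReal.ofReal l := by
        refine h2.trans ((add_le_add_left hcon _).trans ?_)
        rw [ENNReal.add_halves]
      exact absurd hx (not_lt.2 h3)
    · rw [ENNReal.inv_div (Or.inl (by simp)) (Or.inl (by simp)), div_eq_mul_inv]; ring
  have hM := mxm_meas μ hh
  calc ∫⁻ x, mxm μ h x ^ a ∂μ ≤ ∫⁻ x, (ENNReal.ofReal a * ∫⁻ l in Ioi (0 : ℝ),
      {l : ℝ | ENNReal.ofReal l < mxm μ h x}.indicator (fun l => ENNReal.ofReal (l ^ (a - 1))) l) ∂μ :=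
        lintegral_mono fun x => layer_le a (by linarith) _
    _ = ENNReal.ofReal a * ∫⁻ l in Ioi (0 : ℝ), ∫⁻ x,
      {x : ℝ | ENNReal.ofReal l < mxm μ h x}.indicator (fun _ => ENNReal.ofReal (l ^ (a - 1))) x ∂μ := by
        rw [lintegral_const_mul' _ _ (by finiteness), lintegral_lintegral_swap]
        · refine congrArg _ (lintegral_congr fun l => lintegral_congr fun x => ?_)
          by_cases hx : ENNReal.ofReal l < mxm μ h x
          · rw [indicator_of_mem (by exact hx), indicator_of_mem (by exact hx)]
          · rw [indicator_of_notMem (by exact hx), indicator_of_notMem (by exact hx)]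
        · apply Measurable.aemeasurable
          have : MeasurableSet {p : ℝ × ℝ | ENNReal.ofReal p.2 < mxm μ h p.1} :=
            measurableSet_lt (by fun_prop) (by fun_prop)
          exact (Measurable.indicator (f := fun p : ℝ × ℝ => ENNReal.ofReal (p.2 ^ (a - 1)))
            (by fun_prop) this)
    _ ≤ ENNReal.ofReal a * ∫⁻ l in Ioi (0 : ℝ), D * 2 * ∫⁻ x,
      {l : ℝ | ENNReal.ofReal l < 2 * h x}.indicator
        (fun l => ENNReal.ofReal (l ^ (a - 1 - 1))) l * h x ∂μ := by
        gcongr 1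
        refine setLIntegral_mono' measurableSet_Ioi fun l hl => ?_
        have hl : 0 < l := hl
        rw [lintegral_indicator (measurableSet_lt measurable_const hM), setLIntegral_const]
        refine (mul_le_mul_right (wk l hl) _).trans (le_of_eq ?_)
        have e : ENNReal.ofReal (l ^ (a - 1 - 1)) =
            ENNReal.ofReal (l ^ (a - 1)) * (ENNReal.ofReal l)⁻¹ := by
          rw [Real.rpow_sub_one hl.ne', div_eq_mul_inv, ENNReal.ofReal_mul (by positivity),
            ENNReal.ofReal_inv_of_pos hl]
        have e2 : ∀ x, {l : ℝ | ENNReal.ofReal l < 2 * h x}.indicator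
            (fun l => ENNReal.ofReal (l ^ (a - 1 - 1))) l * h x =
            ENNReal.ofReal (l ^ (a - 1 - 1)) * {y | ENNReal.ofReal l < 2 * h y}.indicator h x := by
          intro x
          by_cases hx : ENNReal.ofReal l < 2 * h x
          · rw [indicator_of_mem (by exact hx), indicator_of_mem (by exact hx)]
          · rw [indicator_of_notMem (by exact hx), indicator_of_notMem (by exact hx)]; simp
        simp_rw [e2]
        rw [lintegral_const_mul' _ _ (by finiteness), e]
        ring
    _ = ENNReal.ofReal a * (D * 2) * ∫⁻ x, (∫⁻ l in Ioi (0 : ℝ),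
      {l : ℝ | ENNReal.ofReal l < 2 * h x}.indicator
        (fun l => ENNReal.ofReal (l ^ (a - 1 - 1))) l) * h x ∂μ := by
        rw [lintegral_const_mul' _ _ (by finiteness), lintegral_lintegral_swap]
        · rw [mul_assoc (ENNReal.ofReal a)]
          refine congrArg _ (congrArg _ (lintegral_congr fun x => ?_))
          rw [lintegral_mul_const]
          exact Measurable.indicator (by fun_prop) (measurableSet_lt (by fun_prop) measurable_const)
        · apply Measurable.aemeasurable
          have : MeasurableSet {p : ℝ × ℝ | ENNReal.ofReal p.1 < 2 * h p.2} :=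
            measurableSet_lt (by fun_prop) (by fun_prop)
          exact (Measurable.indicator (f := fun p : ℝ × ℝ => ENNReal.ofReal (p.1 ^ (a - 1 - 1)))
            (by fun_prop) this).mul (by fun_prop)
    _ ≤ ENNReal.ofReal a * (D * 2) * ∫⁻ x, (ENNReal.ofReal (a - 1)⁻¹ * 2 ^ (a - 1)) * h x ^ a ∂μ := by
        refine mul_le_mul_right (lintegral_mono fun x => ?_) _
        refine (mul_le_mul_left (layer_ge (a - 1) (by linarith) _) _).trans (le_of_eq ?_)
        rw [ENNReal.mul_rpow_of_nonneg _ _ (by linarith), mul_assoc, mul_assoc, mul_assoc]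
        congr 2
        nth_rewrite 2 [← ENNReal.rpow_one (h x)]
        rw [← ENNReal.rpow_add_of_nonneg _ _ (by linarith) (by linarith)]
        congr 1; ring
    _ = _ := by
        rw [lintegral_const_mul' _ _ ?_]
        · ring
        · refine ENNReal.mul_ne_top (by finiteness) ?_
          exact ENNReal.rpow_ne_top_of_nonneg (by linarith) (by simp)



/-! ### Weighted bounds for averages -/

instance wm_sfinite (γ : ℝ) : SFinite (wm γ) := by unfold wm; infer_instance

def lpn {α : Type*} [MeasurableSpace α] (μ : Measure α) (p : ℝ) (f : α → ℝ≥0∞) : ℝ≥0∞ :=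
  (∫⁻ x, f x ^ p ∂μ) ^ (1 / p)

theorem lpn_mono {α : Type*} [MeasurableSpace α] (μ : Measure α) (p : ℝ) (hp : 0 < p)
    {f g : α → ℝ≥0∞} (h : ∀ᵐ x ∂μ, f x ≤ g x) : lpn μ p f ≤ lpn μ p g := by
  unfold lpn
  refine ENNReal.rpow_le_rpow (lintegral_mono_ae ?_) (by positivity)
  filter_upwards [h] with x hx using ENNReal.rpow_le_rpow hx hp.le

theorem lpn_add {α : Type*} [MeasurableSpace α] (μ : Measure α) (p : ℝ) (hp : 1 ≤ p)
    {f g : α → ℝ≥0∞} (hf : Measurable f) (hg : Measurable g) :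
    lpn μ p (fun x => f x + g x) ≤ lpn μ p f + lpn μ p g :=
  ENNReal.lintegral_Lp_add_le hf.aemeasurable hg.aemeasurable hp

theorem lpn_mul {α : Type*} [MeasurableSpace α] (μ : Measure α) (p : ℝ) (hp : 0 < p)
    {f : α → ℝ≥0∞} (c : ℝ≥0∞) (hc : c ≠ ⊤) :
    lpn μ p (fun x => c * f x) = c * lpn μ p f := by
  unfold lpn
  simp_rw [ENNReal.mul_rpow_of_nonneg _ _ hp.le]
  rw [lintegral_const_mul' _ _ (ENNReal.rpow_ne_top_of_nonneg hp.le hc),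
    ENNReal.mul_rpow_of_nonneg _ _ (by positivity), ← ENNReal.rpow_mul, mul_one_div_cancel hp.ne',
    ENNReal.rpow_one]

theorem lpn_iSup {α : Type*} [MeasurableSpace α] (μ : Measure α) (p : ℝ) (hp : 0 < p)
    {f : ℕ → α → ℝ≥0∞} (hf : ∀ n, Measurable (f n)) (hm : Monotone f) (B : ℝ≥0∞)
    (hB : ∀ n, lpn μ p (f n) ≤ B) :
    lpn μ p (fun x => ⨆ n, f n x) ≤ B := by
  have hB' : ∀ n, ∫⁻ x, f n x ^ p ∂μ ≤ B ^ p := fun n => by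
    have := ENNReal.rpow_le_rpow (hB n) hp.le
    rwa [lpn, ← ENNReal.rpow_mul, one_div_mul_cancel hp.ne', ENNReal.rpow_one] at this
  have h1 : ∀ x, (⨆ n, f n x) ^ p = ⨆ n, f n x ^ p := fun x =>
    (ENNReal.orderIsoRpow p hp).map_iSup (fun n => f n x)
  unfold lpn
  simp_rw [h1]
  rw [lintegral_iSup (fun n => (hf n).pow_const p)
    (fun i j hij x => ENNReal.rpow_le_rpow (hm hij x) hp.le)]
  calc _ ≤ (B ^ p) ^ (1 / p) := ENNReal.rpow_le_rpow (iSup_le hB') (by positivity)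
    _ = B := by rw [← ENNReal.rpow_mul, mul_one_div_cancel hp.ne', ENNReal.rpow_one]

theorem lpn_tsum {α : Type*} [MeasurableSpace α] (μ : Measure α) (p : ℝ) (hp : 1 ≤ p)
    {f : ℕ → α → ℝ≥0∞} (hf : ∀ n, Measurable (f n)) :
    lpn μ p (fun x => ∑' n, f n x) ≤ ∑' n, lpn μ p (f n) := by
  simp_rw [ENNReal.tsum_eq_iSup_nat]
  refine lpn_iSup μ p (by linarith) (f := fun n x => ∑ i ∈ Finset.range n, f i x)
    (fun n => by fun_prop) ?_ _ fun n => ?_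
  · intro i j hij x
    exact Finset.sum_le_sum_of_subset (Finset.range_mono hij)
  · refine le_trans ?_ (le_iSup _ n)
    induction n with
    | zero => simp [lpn, show 0 < p by linarith]
    | succ n ih =>
      simp_rw [Finset.sum_range_succ]
      exact (lpn_add μ p hp (by fun_prop) (hf n)).trans (add_le_add_left ih _)

theorem wt_rpow (γ a : ℝ) (x : ℝ) (hx : x ≠ 0) : wt γ x ^ a = wt (γ * a) x := by
  have := abs_pos.2 hx
  rw [wt, wt, ENNReal.ofReal_rpow_of_pos (by positivity), ← Real.rpow_mul this.le]

theorem wt_mul (γ δ : ℝ) (x : ℝ) (hx : x ≠ 0) : wt γ x * wt δ x = wt (γ + δ) x := by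
  have := abs_pos.2 hx
  rw [wt, wt, wt, ← ENNReal.ofReal_mul (by positivity), ← Real.rpow_add this]

theorem wt_zero (x : ℝ) : wt 0 x = 1 := by simp [wt]

theorem ae_ne_zero (s : Set ℝ) : ∀ᵐ x ∂(volume.restrict s), x ≠ (0 : ℝ) :=
  ae_restrict_of_ae (by simp [ae_iff])

theorem holder_wt (p γ : ℝ) (hp : 1 < p) {s : Set ℝ} (hs : MeasurableSet s) {B V : ℝ → ℝ≥0∞}
    (hB : Measurable B) (hV : Measurable V) :
    ∫⁻ x in s, B x * V x ≤ (∫⁻ x in s, B x ^ p ∂(wm γ)) ^ (1 / p) *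
      (∫⁻ x in s, V x ^ (p / (p - 1)) ∂(wm (-γ / (p - 1)))) ^ (1 - 1 / p) := by
  have hp0 : 0 < p := by linarith
  have hp1 : 0 < p - 1 := by linarith
  have hpi : 1 / p < 1 := by rw [div_lt_one hp0]; exact hp
  rw [setLint_wm _ _ hs, setLint_wm _ _ hs]
  have hw := wt_meas
  refine le_trans (lintegral_mono_ae ?_) (ENNReal.lintegral_mul_norm_pow_le
    (by fun_prop) (by fun_prop) (by positivity) (by linarith) (by ring))
  filter_upwards [ae_ne_zero s] with x hx
  rw [ENNReal.mul_rpow_of_nonneg _ _ (by positivity),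
    ENNReal.mul_rpow_of_nonneg _ _ (by linarith), ← ENNReal.rpow_mul, ← ENNReal.rpow_mul,
    wt_rpow _ _ _ hx, wt_rpow _ _ _ hx, mul_one_div_cancel hp0.ne', ENNReal.rpow_one,
    show p / (p - 1) * (1 - 1 / p) = 1 by field_simp, ENNReal.rpow_one, mul_mul_mul_comm,
    wt_mul _ _ _ hx, show γ * (1 / p) + -γ / (p - 1) * (1 - 1 / p) = 0 by field_simp; ring,
    wt_zero, one_mul]

def av (k : ℤ) (u : ℝ → ℝ≥0∞) (x : ℝ) : ℝ≥0∞ :=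
  ENNReal.ofReal (((2 : ℝ) ^ k)⁻¹) * ∫⁻ y in Metric.closedBall x ((2 : ℝ) ^ k), u y

def Mx (u : ℝ → ℝ≥0∞) (x : ℝ) : ℝ≥0∞ := ⨆ k : ℤ, av k u x

theorem av_meas (k : ℤ) {u : ℝ → ℝ≥0∞} (hu : Measurable u) : Measurable (av k u) :=
  (ballInt_meas volume hu _).const_mul _

theorem Mx_meas {u : ℝ → ℝ≥0∞} (hu : Measurable u) : Measurable (Mx u) :=
  Measurable.iSup fun k => av_meas k hu

theorem av_le_Mx (k : ℤ) (u : ℝ → ℝ≥0∞) (x : ℝ) : av k u x ≤ Mx u x :=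
  le_iSup (fun k => av k u x) k

theorem av_mono (k : ℤ) {u v : ℝ → ℝ≥0∞} (h : ∀ x, u x ≤ v x) (x : ℝ) : av k u x ≤ av k v x := by
  unfold av; gcongr; exact h _

theorem av_holder (p γ : ℝ) (hp : 1 < p) (hγ : -1 < γ) (hγ2 : γ < p - 1) :
    ∃ C : ℝ≥0∞, C ≠ ⊤ ∧ ∀ u : ℝ → ℝ≥0∞, Measurable u → ∀ k x,
      av k u x ≤ C * ((wm γ (Metric.closedBall x ((2 : ℝ) ^ k)))⁻¹ *
        ∫⁻ y in Metric.closedBall x ((2 : ℝ) ^ k), u y ^ p ∂(wm γ)) ^ (1 / p) := by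
  have hp0 : 0 < p := by linarith
  have hp1 : 0 < p - 1 := by linarith
  have hpi : 1 / p < 1 := by rw [div_lt_one hp0]; exact hp
  obtain ⟨C1, hC1, h1⟩ := wm_ball_upper γ hγ
  obtain ⟨C2, hC2, h2⟩ := wm_ball_upper (-γ / (p - 1)) (by rw [lt_div_iff₀ hp1]; linarith)
  refine ⟨ENNReal.ofReal (C1 ^ (1 / p) * C2 ^ (1 - 1 / p)), ENNReal.ofReal_ne_top,
    fun u hu k x => ?_⟩
  set r : ℝ := (2 : ℝ) ^ k with hr
  have hr0 : 0 < r := by positivity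
  set Bl := Metric.closedBall x r
  have hBm : MeasurableSet Bl := Metric.isClosed_closedBall.measurableSet
  have hxr : 0 < |x| + r := by positivity
  set I := ∫⁻ y in Bl, u y ^ p ∂(wm γ)
  have hH := holder_wt p γ hp hBm hu (measurable_const (a := (1 : ℝ≥0∞)))
  simp only [mul_one, ENNReal.one_rpow, lintegral_const, Measure.restrict_apply_univ, one_mul] at hH
  have e1 : I ^ (1 / p) = ((wm γ Bl)⁻¹ * I) ^ (1 / p) * (wm γ Bl) ^ (1 / p) := by
    rw [← ENNReal.mul_rpow_of_nonneg _ _ (by positivity), mul_right_comm,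
      ENNReal.inv_mul_cancel (wm_ball_pos γ x r hr0) (wm_ball_top γ hγ x r hr0), one_mul]
  calc av k u x ≤ ENNReal.ofReal r⁻¹ * (I ^ (1 / p) * wm (-γ / (p - 1)) Bl ^ (1 - 1 / p)) := by
        unfold av; gcongr
    _ ≤ ENNReal.ofReal r⁻¹ * (((wm γ Bl)⁻¹ * I) ^ (1 / p) *
        ENNReal.ofReal (C1 * (r * (|x| + r) ^ γ)) ^ (1 / p) *
        ENNReal.ofReal (C2 * (r * (|x| + r) ^ (-γ / (p - 1)))) ^ (1 - 1 / p)) := by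
        rw [e1]
        gcongr
        · exact h1 x r hr0
        · exact h2 x r hr0
    _ = (ENNReal.ofReal r⁻¹ *
        ENNReal.ofReal (C1 * (r * (|x| + r) ^ γ)) ^ (1 / p) *
        ENNReal.ofReal (C2 * (r * (|x| + r) ^ (-γ / (p - 1)))) ^ (1 - 1 / p)) *
        ((wm γ Bl)⁻¹ * I) ^ (1 / p) := by ring
    _ = _ := by
        congr 1
        rw [ENNReal.ofReal_rpow_of_pos (by positivity), ENNReal.ofReal_rpow_of_pos (by positivity),
          ← ENNReal.ofReal_mul (by positivity), ← ENNReal.ofReal_mul (by positivity)]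
        congr 1
        rw [Real.mul_rpow (by positivity) (by positivity),
          Real.mul_rpow (by positivity) (by positivity),
          Real.mul_rpow (by positivity) (by positivity),
          Real.mul_rpow (by positivity) (by positivity), ← Real.rpow_mul hxr.le,
          ← Real.rpow_mul hxr.le]
        have e2 : r ^ (1 / p) * r ^ (1 - 1 / p) = r := by
          rw [← Real.rpow_add hr0]; simp
        have e3 : (|x| + r) ^ (γ * (1 / p)) * (|x| + r) ^ (-γ / (p - 1) * (1 - 1 / p)) = 1 := by
          rw [← Real.rpow_add hxr,
            show γ * (1 / p) + -γ / (p - 1) * (1 - 1 / p) = 0 by field_simp; ring, Real.rpow_zero]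
        calc _ = r⁻¹ * (r ^ (1 / p) * r ^ (1 - 1 / p)) * (C1 ^ (1 / p) * C2 ^ (1 - 1 / p)) *
            ((|x| + r) ^ (γ * (1 / p)) * (|x| + r) ^ (-γ / (p - 1) * (1 - 1 / p))) := by ring
          _ = _ := by rw [e2, e3]; field_simp

theorem Mx_strong (p γ : ℝ) (hp : 1 < p) (hγ : -1 < γ) (hγ2 : γ < p - 1) :
    ∃ C : ℝ≥0∞, C ≠ ⊤ ∧ ∀ u : ℝ → ℝ≥0∞, Measurable u →
      lpn (wm γ) p (Mx u) ≤ C * lpn (wm γ) p u := by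
  obtain ⟨ρ, hρ1, hρ2⟩ := exists_between (max_lt hp (show γ + 1 < p by linarith))
  have hρ3 : 1 < ρ := (le_max_left _ _).trans_lt hρ1
  have hρ4 : γ + 1 < ρ := (le_max_right _ _).trans_lt hρ1
  obtain ⟨C1, hC1, h1⟩ := av_holder ρ γ hρ3 hγ (by linarith)
  obtain ⟨D, hD, hD'⟩ := wm_doubling γ hγ
  have ha : 1 < p / ρ := by rw [lt_div_iff₀ (by linarith)]; linarith
  obtain ⟨C2, hC2, h2⟩ := mxm_strong (wm γ) D hD hD' (wm_ball_pos γ) (wm_ball_top γ hγ) (p / ρ) ha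
  have hp0 : 0 < p := by linarith
  refine ⟨C1 * C2 ^ (1 / p), ENNReal.mul_ne_top hC1
    (ENNReal.rpow_ne_top_of_nonneg (by positivity) hC2), fun u hu => ?_⟩
  have h3 : ∀ x, Mx u x ≤ C1 * (mxm (wm γ) (fun y => u y ^ ρ) x) ^ (1 / ρ) := by
    intro x
    refine iSup_le fun k => (h1 u hu k x).trans ?_
    gcongr
    exact le_iSup (fun k : ℤ => (wm γ (Metric.closedBall x ((2 : ℝ) ^ k)))⁻¹ *
      ∫⁻ y in Metric.closedBall x ((2 : ℝ) ^ k), u y ^ ρ ∂(wm γ)) k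
  refine (lpn_mono (wm γ) p hp0 (Filter.Eventually.of_forall h3)).trans ?_
  rw [lpn_mul _ _ hp0 _ hC1, mul_assoc]
  gcongr
  unfold lpn
  rw [← ENNReal.mul_rpow_of_nonneg _ _ (by positivity)]
  refine ENNReal.rpow_le_rpow ?_ (by positivity)
  have := h2 (fun y => u y ^ ρ) (by fun_prop)
  simp_rw [← ENNReal.rpow_mul] at this ⊢
  rw [show ρ * (p / ρ) = p by field_simp] at this
  rwa [show 1 / ρ * p = p / ρ by ring]

/-- Rubio de Francia majorant -/
theorem rubio (p γ : ℝ) (hp : 1 < p) (hγ : -1 < γ) (hγ2 : γ < p - 1) :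
    ∃ C : ℝ≥0∞, C ≠ ⊤ ∧ ∀ F : ℝ → ℝ≥0∞, Measurable F → ∃ U : ℝ → ℝ≥0∞, Measurable U ∧
      (∀ x, F x ≤ U x) ∧ (∀ k x, av k U x ≤ C * U x) ∧
      lpn (wm γ) p U ≤ 2 * lpn (wm γ) p F := by
  obtain ⟨A', hA', hM'⟩ := Mx_strong p γ hp hγ hγ2
  obtain ⟨A, hA, hA0, hM⟩ : ∃ A : ℝ≥0∞, A ≠ ⊤ ∧ A ≠ 0 ∧ ∀ u : ℝ → ℝ≥0∞, Measurable u →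
      lpn (wm γ) p (Mx u) ≤ A * lpn (wm γ) p u :=
    ⟨A' + 1, by finiteness, by simp, fun u hu => (hM' u hu).trans (by gcongr; exact le_self_add)⟩
  have hp0 : 0 < p := by linarith
  have h2A : 2 * A ≠ ⊤ := by finiteness
  have h2A0 : 2 * A ≠ 0 := by simp [hA0]
  refine ⟨2 * A, h2A, fun F hF => ?_⟩
  let G : ℕ → ℝ → ℝ≥0∞ := fun j => Mx^[j] F
  have hGm : ∀ j, Measurable (G j) := by
    intro j
    induction j with
    | zero => exact hF
    | succ j ih =>
      simp only [G, Function.iterate_succ_apply']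
      exact Mx_meas ih
  have hGs : ∀ j x, G (j + 1) x = Mx (G j) x := fun j x => by
    simp only [G, Function.iterate_succ_apply']
  have hGn : ∀ j, lpn (wm γ) p (G j) ≤ A ^ j * lpn (wm γ) p F := by
    intro j
    induction j with
    | zero => simp [G]
    | succ j ih =>
      calc lpn (wm γ) p (G (j + 1)) ≤ A * lpn (wm γ) p (G j) := by
            rw [show G (j + 1) = Mx (G j) from funext (hGs j)]
            exact hM _ (hGm j)
        _ ≤ A * (A ^ j * lpn (wm γ) p F) := by gcongr
        _ = _ := by ring
  have hct : ∀ j : ℕ, ((2 * A)⁻¹) ^ j ≠ ⊤ := fun j => ENNReal.pow_ne_top (ENNReal.inv_ne_top.2 h2A0)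
  refine ⟨fun x => ∑' j, ((2 * A)⁻¹) ^ j * G j x, by fun_prop, fun x => ?_, fun k x => ?_, ?_⟩
  · refine le_trans ?_ (ENNReal.le_tsum 0)
    simp [G]
  · unfold av
    rw [lintegral_tsum (fun j => by fun_prop), ← ENNReal.tsum_mul_left, ← ENNReal.tsum_mul_left]
    calc _ ≤ ∑' j, 2 * A * (((2 * A)⁻¹) ^ (j + 1) * G (j + 1) x) := by
          refine ENNReal.tsum_le_tsum fun j => ?_
          rw [lintegral_const_mul' _ _ (hct j), pow_succ', ← mul_assoc, ← mul_assoc (2 * A),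
            ← mul_assoc (2 * A), ENNReal.mul_inv_cancel h2A0 h2A, one_mul, mul_comm (ENNReal.ofReal _),
            mul_assoc, hGs]
          gcongr
          exact av_le_Mx k (G j) x
      _ ≤ _ := by
          exact ENNReal.tsum_comp_le_tsum_of_injective (add_left_injective 1)
            (fun j => 2 * A * (((2 * A)⁻¹) ^ j * G j x))
  · refine (lpn_tsum (wm γ) p hp.le (fun j => by fun_prop)).trans ?_
    calc _ ≤ ∑' j : ℕ, (2 : ℝ≥0∞)⁻¹ ^ j * lpn (wm γ) p F := by
          refine ENNReal.tsum_le_tsum fun j => ?_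
          rw [lpn_mul _ _ hp0 _ (hct j)]
          calc _ ≤ ((2 * A)⁻¹) ^ j * (A ^ j * lpn (wm γ) p F) := by gcongr; exact hGn j
            _ = _ := by
              rw [← mul_assoc, ← mul_pow, ENNReal.mul_inv (by simp) (by simp), mul_assoc,
                ENNReal.inv_mul_cancel hA0 hA, mul_one]
      _ = _ := by
          rw [ENNReal.tsum_mul_right, ENNReal.tsum_geometric, ENNReal.one_sub_inv_two, inv_inv]



theorem av_symm (k : ℤ) {b E : ℝ → ℝ≥0∞} (hb : Measurable b) (hE : Measurable E) :
    ∫⁻ x, av k b x * E x = ∫⁻ x, b x * av k E x := by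
  set r := (2 : ℝ) ^ k
  have h1 : ∀ (u : ℝ → ℝ≥0∞) (x : ℝ), av k u x = ENNReal.ofReal r⁻¹ *
      ∫⁻ y, ({z : ℝ × ℝ | dist z.2 z.1 ≤ r}.indicator (fun z => u z.2)) (x, y) := by
    intro u x
    unfold av
    rw [← lintegral_indicator Metric.isClosed_closedBall.measurableSet]
    congr 2
  have hS : MeasurableSet {z : ℝ × ℝ | dist z.2 z.1 ≤ r} :=
    measurableSet_le (by fun_prop) (by fun_prop)
  have hm : ∀ u : ℝ → ℝ≥0∞, Measurable u →
      Measurable ({z : ℝ × ℝ | dist z.2 z.1 ≤ r}.indicator (fun z => u z.2)) :=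
    fun u hu => (hu.comp measurable_snd).indicator hS
  have h2 : ∀ x, av k b x * E x = ENNReal.ofReal r⁻¹ *
      ∫⁻ y, ({z : ℝ × ℝ | dist z.2 z.1 ≤ r}.indicator (fun z => b z.2)) (x, y) * E x := by
    intro x
    rw [h1, mul_assoc, ← lintegral_mul_const]
    exact (hm b hb).comp measurable_prodMk_left
  have h3 : ∀ x, b x * av k E x = ENNReal.ofReal r⁻¹ *
      ∫⁻ y, ({z : ℝ × ℝ | dist z.2 z.1 ≤ r}.indicator (fun z => E z.2)) (x, y) * b x := by
    intro x
    rw [h1, mul_comm, mul_assoc, ← lintegral_mul_const]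
    exact (hm E hE).comp measurable_prodMk_left
  simp_rw [h2, h3]
  rw [lintegral_const_mul' _ _ ENNReal.ofReal_ne_top, lintegral_const_mul' _ _ ENNReal.ofReal_ne_top]
  congr 1
  rw [lintegral_lintegral_swap (Measurable.aemeasurable ?_)]
  · refine lintegral_congr fun y => lintegral_congr fun x => ?_
    by_cases hxy : dist x y ≤ r
    · rw [indicator_of_mem (by show dist y x ≤ r; rwa [dist_comm]), indicator_of_mem (by exact hxy)]
      simp [mul_comm]
    · rw [indicator_of_notMem (by show ¬ dist y x ≤ r; rwa [dist_comm]), indicator_of_notMem (by exact hxy)]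
      simp
  · exact (hm b hb).mul (hE.comp measurable_fst)

theorem av_sum (p γ : ℝ) (hp : 1 < p) (hγ : -1 < γ) (hγ2 : γ < p - 1) :
    ∃ C : ℝ≥0∞, C ≠ ⊤ ∧ ∀ b : ℤ → ℝ → ℝ≥0∞, (∀ k, Measurable (b k)) →
      lpn (wm γ) p (fun x => ∑' k, av k (b k) x) ≤ C * lpn (wm γ) p (fun x => ∑' k, b k x) := by
  have hp0 : 0 < p := by linarith
  have hp1 : 0 < p - 1 := by linarith
  obtain ⟨C, hC, hM⟩ := Mx_strong (p / (p - 1)) (-γ / (p - 1)) (by rw [lt_div_iff₀ hp1]; linarith)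
    (by rw [lt_div_iff₀ hp1]; linarith)
    (by rw [show p / (p-1) - 1 = 1 / (p - 1) by field_simp; ring]
        rw [div_lt_div_iff_of_pos_right hp1]; linarith)
  refine ⟨C, hC, fun b hb => ?_⟩
  set H : ℝ → ℝ≥0∞ := fun x => ∑' k, av k (b k) x with hH
  set B : ℝ → ℝ≥0∞ := fun x => ∑' k, b k x with hBd
  have hHm : Measurable H := Measurable.tsum fun k => av_meas k (hb k)
  have hBm : Measurable B := Measurable.tsum fun k => hb k
  set HR : ℕ → ℝ → ℝ≥0∞ := fun n => (Metric.closedBall (0:ℝ) (n + 1)).indicator fun x => min (H x) n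
  have hHRm : ∀ n, Measurable (HR n) := fun n =>
    (hHm.min measurable_const).indicator Metric.isClosed_closedBall.measurableSet
  have hmono : Monotone HR := by
    intro i j hij x
    have hc : (i : ℝ) ≤ j := by exact_mod_cast hij
    refine (indicator_le_indicator_of_subset (Metric.closedBall_subset_closedBall (by linarith))
      (fun _ => bot_le) x).trans (indicator_le_indicator ?_)
    exact min_le_min le_rfl (by exact_mod_cast hij)
  have hsup : ∀ x, H x = ⨆ n, HR n x := by
    intro x
    apply le_antisymm
    · refine le_of_forall_lt fun c hc => ?_
      obtain ⟨n, hn⟩ := ENNReal.exists_nat_gt hc.ne_top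
      obtain ⟨m, hm⟩ := exists_nat_gt |x|
      refine lt_of_lt_of_le ?_ (le_iSup _ (max n m))
      have : x ∈ Metric.closedBall (0:ℝ) ((max n m : ℕ) + 1) := by
        simp only [Metric.mem_closedBall, dist_zero_right, Real.norm_eq_abs]
        have : (m : ℝ) ≤ (max n m : ℕ) := by exact_mod_cast le_max_right _ _
        linarith
      show c < HR _ x
      simp only [HR]
      rw [indicator_of_mem this]
      refine lt_min hc (hn.trans_le ?_)
      exact_mod_cast le_max_left _ _
    · refine iSup_le fun n => (indicator_le_self _ _ x).trans (min_le_left _ _)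
  rw [funext hsup]
  refine lpn_iSup _ _ hp0 hHRm hmono _ fun n => ?_
  set Z := ∫⁻ x, HR n x ^ p ∂(wm γ) with hZ
  have hZt : Z ≠ ⊤ := by
    refine ne_top_of_le_ne_top (b := (n : ℝ≥0∞) ^ p * wm γ (Metric.closedBall 0 (n + 1)))
      (ENNReal.mul_ne_top (by simp [hp0.le])
      (wm_ball_top γ hγ 0 _ (by positivity))) ?_
    rw [← lintegral_indicator_const Metric.isClosed_closedBall.measurableSet]
    refine lintegral_mono fun x => ?_
    simp only [HR]
    by_cases hx : x ∈ Metric.closedBall (0:ℝ) (n + 1)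
    · rw [indicator_of_mem hx, indicator_of_mem hx]
      exact ENNReal.rpow_le_rpow (min_le_right _ _) hp0.le
    · rw [indicator_of_notMem hx, indicator_of_notMem hx]
      simp [hp0]
  set E : ℝ → ℝ≥0∞ := fun x => HR n x ^ (p - 1) * wt γ x with hE
  have hEm : Measurable E := ((hHRm n).pow_const _).mul (wt_meas γ)
  have s1 : Z ≤ ∫⁻ x, H x * E x := by
    rw [hZ, lint_wm]
    refine lintegral_mono fun x => ?_
    simp only [hE]
    rw [show p = 1 + (p - 1) by ring, ENNReal.rpow_add_of_nonneg _ _ zero_le_one hp1.le,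
      ENNReal.rpow_one, add_sub_cancel_left, mul_comm, mul_assoc]
    refine mul_le_mul_left ?_ _
    rw [hsup]; exact le_iSup (fun n => HR n x) n
  have s2 : ∫⁻ x, H x * E x ≤ ∫⁻ x, B x * Mx E x := by
    simp only [hH, hBd, ← ENNReal.tsum_mul_right]
    rw [lintegral_tsum (f := fun k x => av k (b k) x * E x)
        fun k => ((av_meas k (hb k)).mul hEm).aemeasurable,
      lintegral_tsum (f := fun k x => b k x * Mx E x)
        fun k => ((hb k).mul (Mx_meas hEm)).aemeasurable]
    refine ENNReal.tsum_le_tsum fun k => ?_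
    rw [av_symm k (hb k) hEm]
    exact lintegral_mono fun x => mul_le_mul_right (av_le_Mx k E x) _
  have s3 := holder_wt p γ hp MeasurableSet.univ hBm (Mx_meas hEm)
  simp only [Measure.restrict_univ] at s3
  have s4 := hM E hEm
  have hpe : 1 / (p / (p - 1)) = 1 - 1 / p := by field_simp
  have s5 : lpn (wm (-γ / (p - 1))) (p / (p - 1)) E = Z ^ (1 - 1 / p) := by
    unfold lpn
    rw [hpe, hZ, lint_wm, lint_wm]
    congr 1
    refine lintegral_congr_ae ?_
    have h0 := ae_ne_zero univ
    rw [Measure.restrict_univ] at h0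
    filter_upwards [h0] with x hx
    simp only [hE]
    rw [ENNReal.mul_rpow_of_nonneg _ _ (by positivity), ← ENNReal.rpow_mul, wt_rpow _ _ _ hx,
      mul_left_comm, wt_mul _ _ _ hx, mul_comm]
    congr 2
    · field_simp; ring
    · field_simp
  rw [s5] at s4
  unfold lpn at s4
  rw [hpe] at s4
  have s6 : Z ≤ C * lpn (wm γ) p B * Z ^ (1 - 1 / p) :=
    calc Z ≤ _ := s1.trans (s2.trans s3)
      _ ≤ lpn (wm γ) p B * (C * Z ^ (1 - 1/p)) := mul_le_mul_right s4 _
      _ = _ := by ring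
  show Z ^ (1 / p) ≤ _
  by_cases hZ0 : Z = 0
  · rw [hZ0, ENNReal.zero_rpow_of_pos (by positivity)]; exact bot_le
  have hne0 : Z ^ (1 - 1/p) ≠ 0 := by
    intro h; rw [ENNReal.rpow_eq_zero_iff] at h; tauto
  have hnet : Z ^ (1 - 1/p) ≠ ⊤ := by
    intro h; rw [ENNReal.rpow_eq_top_iff] at h; tauto
  rw [← ENNReal.mul_le_mul_iff_left hne0 hnet]
  refine le_trans (le_of_eq ?_) s6
  rw [← ENNReal.rpow_add _ _ hZ0 hZt]
  simp



theorem rpow_one_div_le_iff' {x y : ℝ≥0∞} {z : ℝ} (hz : 0 < z) : x ^ (1 / z) ≤ y ↔ x ≤ y ^ z := by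
  rw [one_div]; exact ENNReal.rpow_inv_le_iff hz

theorem le_rpow_one_div_iff' {x y : ℝ≥0∞} {z : ℝ} (hz : 0 < z) : x ≤ y ^ (1 / z) ↔ x ^ z ≤ y := by
  rw [one_div]; exact ENNReal.le_rpow_inv_iff hz

def lq (q : ℝ≥0∞) (b : ℤ → ℝ≥0∞) : ℝ≥0∞ :=
  if q = ⊤ then ⨆ k, b k else (∑' k, b k ^ q.toReal) ^ (1 / q.toReal)

theorem lq_eq_lpn (q : ℝ≥0∞) (hq : q ≠ ⊤) (b : ℤ → ℝ≥0∞) :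
    lq q b = lpn Measure.count q.toReal b := by
  rw [lq, if_neg hq, lpn, lintegral_count]

theorem toReal_ge_one {q : ℝ≥0∞} (hq : 1 ≤ q) (h : q ≠ ⊤) : 1 ≤ q.toReal := by
  simpa using ENNReal.toReal_mono h hq

theorem lq_mono {q : ℝ≥0∞} (hq : 1 ≤ q) {a b : ℤ → ℝ≥0∞} (h : ∀ k, a k ≤ b k) :
    lq q a ≤ lq q b := by
  by_cases hqt : q = ⊤
  · simp only [lq, hqt, if_true]; exact iSup_mono h
  · rw [lq_eq_lpn q hqt, lq_eq_lpn q hqt]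
    exact lpn_mono _ _ (by linarith [toReal_ge_one hq hqt]) (Filter.Eventually.of_forall h)

theorem lq_tsum {q : ℝ≥0∞} (hq : 1 ≤ q) (y : ℕ → ℤ → ℝ≥0∞) :
    lq q (fun k => ∑' i, y i k) ≤ ∑' i, lq q (y i) := by
  by_cases hqt : q = ⊤
  · simp only [lq, hqt, if_true]
    exact iSup_le fun k => ENNReal.tsum_le_tsum fun i => le_iSup (y i) k
  · simp_rw [lq_eq_lpn q hqt]
    exact lpn_tsum _ _ (toReal_ge_one hq hqt) fun n => measurable_of_countable _

theorem lq_add {q : ℝ≥0∞} (hq : 1 ≤ q) (a b : ℤ → ℝ≥0∞) :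
    lq q (fun k => a k + b k) ≤ lq q a + lq q b := by
  by_cases hqt : q = ⊤
  · simp only [lq, hqt, if_true]
    exact iSup_le fun k => add_le_add (le_iSup a k) (le_iSup b k)
  · simp_rw [lq_eq_lpn q hqt]
    exact lpn_add _ _ (toReal_ge_one hq hqt) (measurable_of_countable _) (measurable_of_countable _)

theorem lq_mul {q : ℝ≥0∞} (hq : 1 ≤ q) (c : ℝ≥0∞) (hc : c ≠ ⊤) (a : ℤ → ℝ≥0∞) :
    lq q (fun k => c * a k) = c * lq q a := by
  by_cases hqt : q = ⊤
  · simp only [lq, hqt, if_true]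
    rw [ENNReal.mul_iSup]
  · simp_rw [lq_eq_lpn q hqt]
    exact lpn_mul _ _ (by linarith [toReal_ge_one hq hqt]) _ hc

theorem lq_shift (q : ℝ≥0∞) (a : ℤ → ℝ≥0∞) (c : ℤ) :
    lq q (fun k => a (k + c)) = lq q a := by
  unfold lq
  split_ifs
  · exact (Equiv.addRight c).iSup_comp (g := a)
  · rw [(Equiv.addRight c).tsum_eq (fun k => a k ^ q.toReal)  |>.symm]; rfl

theorem lq_meas (q : ℝ≥0∞) {g : ℤ → ℝ → ℝ≥0∞} (hg : ∀ k, Measurable (g k)) :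
    Measurable fun x => lq q (fun k => g k x) := by
  unfold lq
  split_ifs
  · exact Measurable.iSup hg
  · exact (Measurable.tsum fun k => (hg k).pow_const _).pow_const _

theorem le_lq {q : ℝ≥0∞} (hq : 1 ≤ q) (a : ℤ → ℝ≥0∞) (k : ℤ) : a k ≤ lq q a := by
  by_cases hqt : q = ⊤
  · simp only [lq, hqt, if_true]
    exact le_iSup a k
  · have h1 := toReal_ge_one hq hqt
    rw [lq, if_neg hqt, le_rpow_one_div_iff' (by linarith)]
    exact ENNReal.le_tsum k

def Nm (γ p : ℝ) (q : ℝ≥0∞) (g : ℤ → ℝ → ℝ≥0∞) : ℝ≥0∞ :=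
  lpn (wm γ) p (fun x => lq q (fun k => g k x))

theorem Nm_mono (γ p : ℝ) (hp : 1 < p) {q : ℝ≥0∞} (hq : 1 ≤ q) {g h : ℤ → ℝ → ℝ≥0∞}
    (H : ∀ᵐ x ∂(wm γ), ∀ k, g k x ≤ h k x) : Nm γ p q g ≤ Nm γ p q h := by
  refine lpn_mono _ _ (by linarith) ?_
  filter_upwards [H] with x hx using lq_mono hq hx

theorem Nm_add (γ p : ℝ) (hp : 1 < p) {q : ℝ≥0∞} (hq : 1 ≤ q) {g h : ℤ → ℝ → ℝ≥0∞}
    (hg : ∀ k, Measurable (g k)) (hh : ∀ k, Measurable (h k)) :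
    Nm γ p q (fun k x => g k x + h k x) ≤ Nm γ p q g + Nm γ p q h := by
  refine le_trans ?_ (lpn_add _ _ hp.le (lq_meas q hg) (lq_meas q hh))
  exact lpn_mono _ _ (by linarith) (Filter.Eventually.of_forall fun x => lq_add hq _ _)

theorem Nm_mul (γ p : ℝ) (hp : 1 < p) {q : ℝ≥0∞} (hq : 1 ≤ q) (g : ℤ → ℝ → ℝ≥0∞)
    (c : ℝ≥0∞) (hc : c ≠ ⊤) : Nm γ p q (fun k x => c * g k x) = c * Nm γ p q g := by
  unfold Nm
  simp_rw [lq_mul hq c hc]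
  exact lpn_mul _ _ (by linarith) c hc

theorem Nm_tsum (γ p : ℝ) (hp : 1 < p) {q : ℝ≥0∞} (hq : 1 ≤ q) {y : ℕ → ℤ → ℝ → ℝ≥0∞}
    (hg : ∀ i k, Measurable (y i k)) :
    Nm γ p q (fun k x => ∑' i, y i k x) ≤ ∑' i, Nm γ p q (y i) := by
  refine le_trans ?_ (lpn_tsum _ _ hp.le fun i => lq_meas q (hg i))
  exact lpn_mono _ _ (by linarith) (Filter.Eventually.of_forall fun x => lq_tsum hq _)

theorem Nm_shift (γ p : ℝ) (q : ℝ≥0∞) (g : ℤ → ℝ → ℝ≥0∞) (c : ℤ) :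
    Nm γ p q (fun k x => g (k + c) x) = Nm γ p q g := by
  unfold Nm
  congr 1
  funext x
  exact lq_shift q (fun k => g k x) c

theorem FS (p γ : ℝ) (q : ℝ≥0∞) (hp : 1 < p) (hγ : -1 < γ) (hγ2 : γ < p - 1) (hq : 1 ≤ q) :
    ∃ C : ℝ≥0∞, C ≠ ⊤ ∧ ∀ g : ℤ → ℝ → ℝ≥0∞, (∀ k, Measurable (g k)) →
      Nm γ p q (fun k => av k (g k)) ≤ C * Nm γ p q g := by
  by_cases hqt : q = ⊤
  · obtain ⟨C, hC, hM⟩ := Mx_strong p γ hp hγ hγ2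
    refine ⟨C, hC, fun g hg => le_trans ?_ (hM _ (lq_meas q hg))⟩
    refine lpn_mono _ _ (by linarith) (Filter.Eventually.of_forall fun x => ?_)
    rw [lq, if_pos hqt]
    exact iSup_le fun k => (av_mono k (fun y => le_lq hq _ k) x).trans (av_le_Mx k _ x)
  set Q := q.toReal
  have hQ : 1 ≤ Q := toReal_ge_one hq hqt
  have hQ0 : 0 < Q := by linarith
  have hQi : 0 ≤ 1 - 1 / Q := by rw [sub_nonneg, div_le_one hQ0]; exact hQ
  obtain ⟨C, hC, hU⟩ := rubio p γ hp hγ hγ2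
  obtain ⟨C1, hC1, hS⟩ := av_sum p γ hp hγ hγ2
  refine ⟨(C1 + C) * 2, by finiteness, fun g hg => ?_⟩
  obtain ⟨U, hUm, hFU, hav, hUn⟩ := hU _ (lq_meas q hg)
  set b : ℤ → ℝ → ℝ≥0∞ := fun k x => if U x = ⊤ then ⊤ else g k x ^ Q * U x ^ (1 - Q) with hb
  have hbm : ∀ k, Measurable (b k) := fun k =>
    Measurable.ite (hUm (measurableSet_singleton _)) measurable_const
      (((hg k).pow_const _).mul (hUm.pow_const _))
  have hbs : ∀ x, ∑' k, b k x ≤ U x := by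
    intro x
    by_cases hx : U x = ⊤
    · rw [hx]; exact le_top
    simp only [hb, if_neg hx]
    rw [ENNReal.tsum_mul_right]
    have hF : ∑' k, g k x ^ Q ≤ U x ^ Q := by
      have := hFU x
      rwa [lq, if_neg hqt, rpow_one_div_le_iff' hQ0] at this
    by_cases h0 : U x = 0
    · rw [h0, ENNReal.zero_rpow_of_pos hQ0] at hF
      rw [le_antisymm hF bot_le, zero_mul]; exact bot_le
    · refine (mul_le_mul_left hF _).trans ?_
      rw [← ENNReal.rpow_add _ _ h0 hx]; simp
  have hgb : ∀ k x, g k x ≤ b k x ^ (1 / Q) * U x ^ (1 - 1 / Q) := by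
    intro k x
    by_cases h0 : U x = 0
    · have : g k x ≤ U x := (le_lq hq (fun k => g k x) k).trans (hFU x)
      rw [h0] at this
      exact this.trans bot_le
    by_cases hx : U x = ⊤
    · simp only [hb, if_pos hx]
      rw [hx, ENNReal.top_rpow_of_pos (by positivity), ENNReal.top_mul]
      · exact le_top
      · intro h; rw [ENNReal.rpow_eq_zero_iff] at h; rcases h with h | h
        · simp at h
        · linarith [h.2]
    simp only [hb, if_neg hx]
    rw [ENNReal.mul_rpow_of_nonneg _ _ (by positivity), ← ENNReal.rpow_mul, ← ENNReal.rpow_mul, mul_assoc,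
      ← ENNReal.rpow_add _ _ h0 hx, mul_one_div_cancel hQ0.ne',
      show (1 - Q) * (1 / Q) + (1 - 1 / Q) = 0 by field_simp; ring]
    simp
  have hk : ∀ k x, av k (g k) x ^ Q ≤ av k (b k) x * (C * U x) ^ (Q - 1) := by
    intro k x
    have h1 : av k (g k) x ≤ av k (b k) x ^ (1 / Q) * av k U x ^ (1 - 1 / Q) := by
      unfold av
      set c := ENNReal.ofReal ((2:ℝ) ^ k)⁻¹
      rw [ENNReal.mul_rpow_of_nonneg _ _ (by positivity), ENNReal.mul_rpow_of_nonneg _ _ hQi,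
        mul_mul_mul_comm, ← ENNReal.rpow_add_of_nonneg _ _ (by positivity) hQi,
        add_sub_cancel, ENNReal.rpow_one]
      refine mul_le_mul_right ((lintegral_mono fun y => hgb k y).trans ?_) _
      exact ENNReal.lintegral_mul_norm_pow_le (hbm k).aemeasurable hUm.aemeasurable
        (by positivity) hQi (by ring)
    calc av k (g k) x ^ Q ≤ (av k (b k) x ^ (1 / Q) * (C * U x) ^ (1 - 1 / Q)) ^ Q := by
          refine ENNReal.rpow_le_rpow (h1.trans (mul_le_mul_right ?_ _)) hQ0.le
          exact ENNReal.rpow_le_rpow (hav k x) hQi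
      _ = _ := by
          rw [ENNReal.mul_rpow_of_nonneg _ _ hQ0.le, ← ENNReal.rpow_mul, ← ENNReal.rpow_mul,
            one_div_mul_cancel hQ0.ne', ENNReal.rpow_one]
          congr 2; field_simp
  have hpt : ∀ x, lq q (fun k => av k (g k) x) ≤ ∑' k, av k (b k) x + C * U x := by
    intro x
    set H := ∑' k, av k (b k) x
    rw [lq, if_neg hqt, rpow_one_div_le_iff' hQ0]
    calc ∑' k, av k (g k) x ^ Q ≤ H * (C * U x) ^ (Q - 1) := by
          rw [← ENNReal.tsum_mul_right]; exact ENNReal.tsum_le_tsum fun k => hk k x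
      _ ≤ (H + C * U x) ^ (1:ℝ) * (H + C * U x) ^ (Q - 1) := by
          rw [ENNReal.rpow_one]
          exact mul_le_mul' le_self_add (ENNReal.rpow_le_rpow le_add_self (by linarith))
      _ = _ := by
          rw [← ENNReal.rpow_add_of_nonneg _ _ zero_le_one (by linarith)]; congr 1; ring
  calc Nm γ p q (fun k => av k (g k)) ≤ lpn (wm γ) p (fun x => ∑' k, av k (b k) x + C * U x) :=
        lpn_mono _ _ (by linarith) (Filter.Eventually.of_forall hpt)
    _ ≤ C1 * lpn (wm γ) p (fun x => ∑' k, b k x) + C * lpn (wm γ) p U := by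
        refine (lpn_add _ _ hp.le (Measurable.tsum fun k => av_meas k (hbm k)) (hUm.const_mul C)).trans ?_
        exact add_le_add (hS b hbm) (lpn_mul _ _ (by linarith) C hC).le
    _ ≤ C1 * lpn (wm γ) p U + C * lpn (wm γ) p U := by
        gcongr
        exact lpn_mono _ _ (by linarith) (Filter.Eventually.of_forall hbs)
    _ = (C1 + C) * lpn (wm γ) p U := by ring
    _ ≤ (C1 + C) * (2 * Nm γ p q g) := mul_le_mul_right hUn _
    _ = _ := by ring



/-- coefficient -/
def cf (m j : ℕ) : ℝ := (-1 : ℝ) ^ j * (m.choose j)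

def eD (m : ℕ) (h : ℝ) (f : ℝ → X) (x : ℝ) : X :=
  ∑ j ∈ Finset.range (m + 1), cf m j • f (x + j * h)

theorem mDiff_eq_eD (m : ℕ) (h : ℝ) (f : ℝ → X) (x : ℝ) :
    mDiff m h f x = (-1 : ℝ) ^ m • eD m h f x := by
  unfold mDiff eD
  rw [← Finset.sum_range_reflect, Finset.smul_sum]
  refine Finset.sum_congr rfl fun j hj => ?_
  have hj' : j ≤ m := by simpa [Nat.lt_succ_iff] using hj
  have e : m + 1 - 1 - j = m - j := by omega
  rw [e, smul_smul, Nat.choose_symm hj', cf, Nat.cast_sub hj', ← mul_assoc]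
  congr 2
  · have h3 : (-1 : ℝ) ^ j * (-1) ^ j = 1 := by rw [← mul_pow]; simp
    have h4 : (-1 : ℝ) ^ (m - j) * (-1) ^ j = (-1) ^ m := by rw [← pow_add]; congr 1; omega
    rw [← h4, mul_assoc ((-1 : ℝ) ^ (m - j)), h3, mul_one]
  · ring_nf

theorem mDiff_eq_fwd (m : ℕ) (h : ℝ) (f : ℝ → X) (x : ℝ) :
    mDiff m h f x = (fwdDiff h)^[m] f x := by
  rw [fwdDiff_iter_eq_sum_shift, mDiff_eq_eD, eD, Finset.smul_sum]
  refine Finset.sum_congr rfl fun j hj => ?_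
  have hj' : j ≤ m := by simpa [Nat.lt_succ_iff] using hj
  rw [smul_smul, cf, nsmul_eq_mul, ← mul_assoc]
  rw [← Int.cast_smul_eq_zsmul ℝ]
  congr 1
  push_cast
  have h3 : (-1 : ℝ) ^ j * (-1) ^ j = 1 := by rw [← mul_pow]; simp
  have h4 : (-1 : ℝ) ^ (m - j) * (-1) ^ j = (-1) ^ m := by rw [← pow_add]; congr 1; omega
  rw [← h4, mul_assoc ((-1 : ℝ) ^ (m - j)), h3, mul_one]

def Ph (m : ℕ) (f : ℝ → X) (y h : ℝ) : ℝ≥0∞ := ‖mDiff m h f y‖ₑ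

theorem Ph_eq (m : ℕ) (f : ℝ → X) (y h : ℝ) : Ph m f y h = ‖eD m h f y‖ₑ := by
  rw [Ph, mDiff_eq_eD, enorm_smul]
  simp

theorem Ph_neg (m : ℕ) (f : ℝ → X) (y h : ℝ) : Ph m f y (-h) = Ph m f (y - m * h) h := by
  rw [Ph_eq, Ph]
  unfold eD mDiff
  congr 1
  refine Finset.sum_congr rfl fun j hj => ?_
  rw [cf]
  congr 2
  ring

theorem Ph_succ (m : ℕ) (f : ℝ → X) (y h : ℝ) :
    Ph (m + 1) f y h ≤ Ph m f (y + h) h + Ph m f y h := by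
  unfold Ph
  rw [mDiff_eq_fwd, mDiff_eq_fwd, mDiff_eq_fwd, Function.iterate_succ_apply']
  exact enorm_sub_le

theorem fwd_double (m : ℕ) (h : ℝ) (f : ℝ → X) (x : ℝ) :
    (fwdDiff (2 * h))^[m] f x = ∑ i ∈ Finset.range (m + 1),
      (m.choose i) • (fwdDiff h)^[m] f (x + i * h) := by
  have e : fwdDiff_aux.fwdDiffₗ ℝ X (2 * h) =
      (fwdDiff_aux.shiftₗ ℝ X h + 1) * fwdDiff_aux.fwdDiffₗ ℝ X h := by
    ext g y
    simp only [fwdDiff_aux.coe_fwdDiffₗ, fwdDiff, Module.End.mul_apply, LinearMap.add_apply,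
      Module.End.one_apply, Pi.add_apply, fwdDiff_aux.shiftₗ_apply]
    rw [show y + 2 * h = y + h + h by ring]; abel
  have hc : Commute (fwdDiff_aux.shiftₗ ℝ X h + 1) (fwdDiff_aux.fwdDiffₗ ℝ X h) := by
    unfold fwdDiff_aux.shiftₗ
    exact (((Commute.refl _).add_left (Commute.one_left _)).add_left (Commute.one_left _))
  rw [← fwdDiff_aux.coe_fwdDiffₗ_pow, e, hc.mul_pow, Commute.add_pow (Commute.one_right _)]
  simp only [one_pow, mul_one]
  rw [Module.End.mul_apply, LinearMap.sum_apply, Finset.sum_apply]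
  refine Finset.sum_congr rfl fun i _ => ?_
  rw [(Nat.cast_commute _ _).eq.symm, ← nsmul_eq_mul, LinearMap.smul_apply, Pi.smul_apply,
    fwdDiff_aux.shiftₗ_pow_apply, fwdDiff_aux.coe_fwdDiffₗ_pow, nsmul_eq_mul]

theorem fwd_tele (m : ℕ) (h : ℝ) (f : ℝ → X) (x : ℝ) (i : ℕ) :
    (fwdDiff h)^[m] f (x + i * h) = (fwdDiff h)^[m] f x +
      ∑ j ∈ Finset.range i, (fwdDiff h)^[m + 1] f (x + j * h) := by
  induction i with
  | zero => simp
  | succ i ih =>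
    rw [Finset.sum_range_succ, ← add_assoc, ← ih, Function.iterate_succ_apply', fwdDiff]
    push_cast
    rw [show x + (i + 1) * h = x + i * h + h by ring]; abel

theorem Ph_marchaud (m : ℕ) (f : ℝ → X) (y h : ℝ) :
    2 ^ m * Ph m f y h ≤ Ph m f y (2 * h) +
      2 ^ m * ∑ j ∈ Finset.range m, Ph (m + 1) f (y + j * h) h := by
  have h1 := fwd_double m h f y
  simp_rw [fwd_tele m h f y, smul_add, Finset.sum_add_distrib] at h1
  rw [← Finset.sum_smul, Nat.sum_range_choose] at h1
  have h2 : (2 : ℝ) ^ m • mDiff m h f y = mDiff m (2 * h) f y -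
    ∑ i ∈ Finset.range (m + 1), (m.choose i) • ∑ j ∈ Finset.range i, mDiff (m + 1) h f (y + j * h) := by
    simp_rw [mDiff_eq_fwd]
    rw [h1, add_sub_cancel_right, ← Nat.cast_smul_eq_nsmul ℝ]; simp
  have h3 : 2 ^ m * Ph m f y h = ‖(2 : ℝ) ^ m • mDiff m h f y‖ₑ := by
    rw [enorm_smul, Ph, enorm_pow]; congr 2
    rw [Real.enorm_eq_ofReal (by norm_num)]; simp
  rw [h3, h2]
  refine enorm_sub_le.trans (add_le_add le_rfl ?_)
  refine (enorm_sum_le _ _).trans ?_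
  have h4 : (2 : ℝ≥0∞) ^ m = ∑ i ∈ Finset.range (m + 1), ((m.choose i : ℕ) : ℝ≥0∞) := by
    rw [← Nat.cast_sum, Nat.sum_range_choose]; simp
  rw [h4, Finset.sum_mul]
  refine Finset.sum_le_sum fun i hi => ?_
  rw [← Nat.cast_smul_eq_nsmul ℝ, enorm_smul, Real.enorm_eq_ofReal (by positivity), ENNReal.ofReal_natCast]
  refine mul_le_mul_right ((enorm_sum_le _ _).trans ?_) _
  refine Finset.sum_le_sum_of_subset ?_
  intro j hj; simp at hi hj ⊢; omega

theorem eD_zero (m : ℕ) (hm : m ≠ 0) (f : ℝ → X) (x : ℝ) : eD m 0 f x = 0 := by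
  unfold eD
  simp only [mul_zero, add_zero, ← Finset.sum_smul]
  have h := add_pow (-1 : ℝ) 1 m
  simp [hm] at h
  simp [cf, ← h]

theorem eD_ident (m : ℕ) (h r : ℝ) (f : ℝ → X) (z : ℝ) :
    ∑ j ∈ Finset.range (m + 1), cf m j • eD m (h + j * r) f z =
    ∑ i ∈ Finset.range (m + 1), cf m i • eD m (i * r) f (z + i * h) := by
  unfold eD
  simp_rw [Finset.smul_sum]
  rw [Finset.sum_comm]
  refine Finset.sum_congr rfl fun i _ => Finset.sum_congr rfl fun j _ => ?_
  rw [smul_comm]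
  congr 3
  ring

theorem cf_enorm (m j : ℕ) : ‖cf m j‖ₑ ≤ 2 ^ m := by
  rw [cf, enorm_mul, enorm_pow, enorm_neg, enorm_one, one_pow, one_mul,
    Real.enorm_eq_ofReal (by positivity), ENNReal.ofReal_natCast]
  exact_mod_cast Nat.choose_le_two_pow m j

theorem Ph_ident (m : ℕ) (hm : m ≠ 0) (f : ℝ → X) (z h r : ℝ) :
    Ph m f z h ≤ 2 ^ m * ∑ j ∈ Finset.range m,
      (Ph m f (z + (j + 1 : ℕ) * h) ((j + 1 : ℕ) * r) + Ph m f z (h + (j + 1 : ℕ) * r)) := by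
  have h1 := eD_ident m h r f z
  rw [Finset.sum_range_succ', Finset.sum_range_succ'] at h1
  simp only [Nat.cast_zero, zero_mul, add_zero, eD_zero m hm, smul_zero] at h1
  have h2 : cf m 0 = 1 := by simp [cf]
  rw [h2, one_smul] at h1
  have h3 := eq_sub_of_add_eq' h1
  rw [Ph_eq, h3, ← Finset.sum_sub_distrib, Finset.mul_sum]
  refine (enorm_sum_le _ _).trans (Finset.sum_le_sum fun j _ => ?_)
  refine enorm_sub_le.trans ?_
  rw [mul_add, enorm_smul, enorm_smul, Ph_eq, Ph_eq]
  gcongr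
  · exact cf_enorm _ _
  · exact cf_enorm _ _

theorem Ph_meas (m : ℕ) {f : ℝ → X} (hf : StronglyMeasurable f) :
    Measurable fun z : ℝ × ℝ => Ph m f z.1 z.2 := by
  unfold Ph mDiff
  refine StronglyMeasurable.enorm ?_
  refine Finset.stronglyMeasurable_fun_sum _ fun j _ => ?_
  exact (hf.comp_measurable (by fun_prop)).const_smul _



theorem lint_affine (a : ℝ) (ha : a ≠ 0) (x : ℝ) (F : ℝ → ℝ≥0∞) :
    ∫⁻ h, F (x + a * h) = ENNReal.ofReal |a⁻¹| * ∫⁻ y, F y := by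
  have h1 : ∫⁻ h, F (x + a * h) = ∫⁻ y, F (x + y) ∂(Measure.map (a * ·) volume) :=
    ((Homeomorph.mulLeft₀ a ha).toMeasurableEquiv.measurableEmbedding.lintegral_map
      (fun y => F (x + y))).symm
  rw [h1, Real.map_volume_mul_left ha, lintegral_smul_measure, lintegral_add_left_eq_self F x]
  rfl

theorem lint_change (a : ℝ) (ha : 1 ≤ |a|) (x : ℝ) (F : ℝ → ℝ≥0∞) {S S' : Set ℝ}
    (hS : MeasurableSet S) (hS' : MeasurableSet S') (h : ∀ r ∈ S, x + a * r ∈ S') :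
    ∫⁻ r in S, F (x + a * r) ≤ ∫⁻ y in S', F y := by
  have ha0 : a ≠ 0 := by rintro rfl; simp at ha; linarith
  rw [← lintegral_indicator hS, ← lintegral_indicator hS']
  calc ∫⁻ r, S.indicator (fun r => F (x + a * r)) r ≤ ∫⁻ r, S'.indicator F (x + a * r) := by
        refine lintegral_mono fun r => ?_
        by_cases hr : r ∈ S
        · rw [indicator_of_mem hr, indicator_of_mem (h r hr)]
        · rw [indicator_of_notMem hr]; exact bot_le
    _ = ENNReal.ofReal |a⁻¹| * ∫⁻ y, S'.indicator F y := lint_affine a ha0 x _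
    _ ≤ 1 * _ := by
        refine mul_le_mul_left ?_ _
        rw [ENNReal.ofReal_le_one, abs_inv]
        exact inv_le_one_of_one_le₀ ha
    _ = _ := one_mul _

theorem two_zpow_pos (k : ℤ) : (0 : ℝ) < 2 ^ k := by positivity

theorem two_zpow_add (k : ℤ) (c : ℕ) : (2 : ℝ) ^ (k + c) = 2 ^ c * 2 ^ k := by
  rw [zpow_add₀ two_ne_zero, zpow_natCast, mul_comm]

theorem av_mul (k : ℤ) (u : ℝ → ℝ≥0∞) (x : ℝ) : ENNReal.ofReal (2 ^ k) * av k u x =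
    ∫⁻ y in Metric.closedBall x ((2 : ℝ) ^ k), u y := by
  have := two_zpow_pos k
  rw [av, ← mul_assoc, ← ENNReal.ofReal_mul this.le, mul_inv_cancel₀ this.ne', ENNReal.ofReal_one, one_mul]

theorem lint_sum_pair {μ : Measure ℝ} (s : Finset ℕ) {A B : ℕ → ℝ → ℝ≥0∞} (hA : ∀ j, Measurable (A j))
    (hB : ∀ j, Measurable (B j)) :
    ∫⁻ r, ∑ j ∈ s, (A j r + B j r) ∂μ = ∑ j ∈ s, ∫⁻ r, (A j r + B j r) ∂μ :=
  lintegral_finsetSum _ fun j _ => (hA j).add (hB j)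

theorem lemT (a : ℤ) (c : ℕ) (hac : |(a : ℝ)| ≤ 2 ^ c) (k : ℤ) (G : ℝ → ℝ≥0∞) (x : ℝ) :
    ∫⁻ h in Ioo 0 ((2 : ℝ) ^ k), G (x + a * h) ≤
      ENNReal.ofReal (2 ^ k) * (2 ^ c * (G x + av (k + c) G x)) := by
  have h2 : ENNReal.ofReal (2 ^ (k + c)) = ENNReal.ofReal (2 ^ k) * 2 ^ c := by
    rw [two_zpow_add, ENNReal.ofReal_mul (by positivity), mul_comm, ENNReal.ofReal_pow (by norm_num)]
    simp
  by_cases ha : a = 0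
  · subst ha
    simp only [Int.cast_zero, zero_mul, add_zero, lintegral_const, Measure.restrict_apply_univ,
      Real.volume_Ioo, sub_zero]
    rw [mul_comm]
    refine mul_le_mul_right ?_ _
    calc G x ≤ 1 * (G x + av (k + c) G x) := by rw [one_mul]; exact le_self_add
      _ ≤ _ := mul_le_mul_left (one_le_pow₀ (by norm_num)) _
  · have ha1 : 1 ≤ |(a : ℝ)| := by exact_mod_cast Int.one_le_abs ha
    refine (lint_change a ha1 x G measurableSet_Ioo Metric.isClosed_closedBall.measurableSet
      (S' := Metric.closedBall x (2 ^ (k + c))) ?_).trans ?_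
    · intro r hr
      rw [Metric.mem_closedBall, Real.dist_eq, add_sub_cancel_left, abs_mul, abs_of_pos hr.1, two_zpow_add]
      exact mul_le_mul hac hr.2.le hr.1.le (by positivity)
    · rw [← av_mul, h2, mul_assoc]
      gcongr
      exact le_add_self

def Pd (I : Set ℝ) (m : ℕ) (f : ℝ → X) (k : ℤ) (x : ℝ) : ℝ≥0∞ :=
  I.indicator (fun y => ∫⁻ h in Ioo 0 ((2 : ℝ) ^ k), Ph m f y h) x

theorem Pd_meas {I : Set ℝ} (hI : MeasurableSet I) (m : ℕ) {f : ℝ → X} (hf : StronglyMeasurable f)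
    (k : ℤ) : Measurable (Pd I m f k) :=
  ((Ph_meas m hf).lintegral_prod_right' (ν := volume.restrict (Ioo 0 ((2 : ℝ) ^ k)))).indicator hI

theorem lemC {I : Set ℝ} (hI : MeasurableSet I) (hIu : IsUpperSet I) (m : ℕ) (hm : m ≠ 0) (l : ℤ)
    (hl : |l| ≤ m) {f : ℝ → X} (hf : StronglyMeasurable f) (k : ℤ) (x : ℝ) :
    ∫⁻ h in Ioo 0 ((2 : ℝ) ^ k), I.indicator (fun y => Ph m f y h) (x + l * h) ≤
      (2 ^ m * (m * (2 * 2 ^ (m + 1)))) * (Pd I m f (k + (m + 1 : ℕ)) x +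
        av (k + (m + 1 : ℕ)) (Pd I m f (k + (m + 1 : ℕ))) x) := by
  set c := m + 1 with hc
  have hmc : (2 : ℝ) * m ≤ 2 ^ c := by
    have : m < 2 ^ m := Nat.lt_two_pow_self
    have h2 : (m : ℝ) ≤ 2 ^ m := by exact_mod_cast this.le
    rw [hc, pow_succ]; linarith
  have hmc' : (m : ℝ) + 1 ≤ 2 ^ c := by
    have : (1 : ℝ) ≤ m := by exact_mod_cast Nat.one_le_iff_ne_zero.2 hm
    linarith
  have hlr : |(l : ℝ)| ≤ m := by exact_mod_cast hl
  set G := Pd I m f (k + c) with hG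
  have hGm : Measurable G := Pd_meas hI m hf _
  set K := ENNReal.ofReal (2 ^ k) with hK
  have hk0 := two_zpow_pos k
  have hK0 : K ≠ 0 := by rw [hK]; simp [hk0]
  have hKt : K ≠ ⊤ := ENNReal.ofReal_ne_top
  -- inner bound
  have inner : ∀ h ∈ Ioo 0 ((2 : ℝ) ^ k), I.indicator (fun y => Ph m f y h) (x + l * h) * K ≤
      2 ^ m * ∑ j ∈ Finset.range m, (G (x + (l + (j + 1 : ℕ) : ℤ) * h) + G (x + l * h)) := by
    intro h hh
    by_cases hx : x + l * h ∈ I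
    swap
    · rw [indicator_of_notMem hx, zero_mul]; exact bot_le
    rw [indicator_of_mem hx]
    have e1 : Ph m f (x + l * h) h * K = ∫⁻ r in Ioo 0 ((2 : ℝ) ^ k), Ph m f (x + l * h) h := by
      simp [hK]
    rw [e1]
    refine (lintegral_mono fun r => Ph_ident m hm f (x + l * h) h r).trans ?_
    have hPm : ∀ y a b : ℝ, Measurable fun r => Ph m f y (a + b * r) := fun y a b =>
      (Ph_meas m hf).comp (f := fun r => (y, a + b * r)) (by fun_prop)
    have hPm0 : ∀ y b : ℝ, Measurable fun r => Ph m f y (b * r) := fun y b =>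
      (Ph_meas m hf).comp (f := fun r => (y, b * r)) (by fun_prop)
    rw [lintegral_const_mul' _ _ (by finiteness),
      lint_sum_pair _ (fun j => hPm0 (x + l * h + (j + 1 : ℕ) * h) (j + 1 : ℕ))
      (fun j => hPm (x + l * h) h (j + 1 : ℕ))]
    refine mul_le_mul_right (Finset.sum_le_sum fun j hj => ?_) _
    have hj1 : ((j + 1 : ℕ) : ℝ) ≤ m := by
      have : j + 1 ≤ m := by simpa using hj
      exact_mod_cast this
    have hj2 : (1 : ℝ) ≤ |((j + 1 : ℕ) : ℝ)| := by
      rw [abs_of_nonneg (by positivity)]; push_cast; linarith [(Nat.cast_nonneg j : (0:ℝ) ≤ j)]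
    have hj3 : (0 : ℝ) < ((j + 1 : ℕ) : ℝ) := by positivity
    rw [lintegral_add_left (hPm0 _ _)]
    refine add_le_add ?_ ?_
    · have hy : x + (l + (j + 1 : ℕ) : ℤ) * h ∈ I := by
        refine hIu ?_ hx
        push_cast
        have := hh.1
        have : 0 ≤ ((j:ℝ) + 1) * h := by positivity
        linarith
      rw [hG, Pd, indicator_of_mem hy]
      have e2 : x + l * h + (j + 1 : ℕ) * h = x + (l + (j + 1 : ℕ) : ℤ) * h := by push_cast; ring
      rw [e2]
      have := lint_change ((j + 1 : ℕ) : ℝ) hj2 0 (fun t => Ph m f (x + (l + (j + 1 : ℕ) : ℤ) * h) t)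
        (S := Ioo 0 ((2 : ℝ) ^ k)) (S' := Ioo 0 ((2 : ℝ) ^ (k + c))) measurableSet_Ioo measurableSet_Ioo ?_
      · simpa using this
      · intro r hr
        rw [zero_add, two_zpow_add]
        exact ⟨mul_pos hj3 hr.1, mul_lt_mul' (by linarith) hr.2 hr.1.le (by positivity)⟩
    · rw [hG, Pd, indicator_of_mem hx]
      refine lint_change ((j + 1 : ℕ) : ℝ) hj2 h (fun t => Ph m f (x + l * h) t)
        measurableSet_Ioo measurableSet_Ioo ?_
      intro r hr
      rw [two_zpow_add]
      refine ⟨by have := mul_pos hj3 hr.1; linarith [hh.1], ?_⟩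
      have : ((j + 1 : ℕ) : ℝ) * r ≤ m * 2 ^ k := mul_le_mul hj1 hr.2.le hr.1.le (by positivity)
      have h5 : ((m : ℝ) + 1) * 2 ^ k ≤ 2 ^ c * 2 ^ k := mul_le_mul_of_nonneg_right hmc' hk0.le
      linarith [hh.2]
  have hGa : ∀ a : ℤ, Measurable fun h : ℝ => G (x + a * h) := fun a => hGm.comp (by fun_prop)
  rw [← ENNReal.mul_le_mul_iff_left hK0 hKt, ← lintegral_mul_const' _ _ hKt]
  refine (setLIntegral_mono' measurableSet_Ioo inner).trans ?_
  rw [lintegral_const_mul' _ _ (by finiteness),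
    lint_sum_pair _ (fun j => hGa (l + (j + 1 : ℕ) : ℤ)) (fun j => hGa l)]
  have hs : ∀ j ∈ Finset.range m, ∫⁻ h in Ioo 0 ((2 : ℝ) ^ k),
      (G (x + (l + (j + 1 : ℕ) : ℤ) * h) + G (x + l * h)) ≤ 2 * (K * (2 ^ c * (G x + av (k + c) G x))) := by
    intro j hj
    have hj1 : ((j + 1 : ℕ) : ℝ) ≤ m := by
      have : j + 1 ≤ m := by simpa using hj
      exact_mod_cast this
    rw [lintegral_add_left (hGa _), two_mul]
    refine add_le_add (lemT _ c ?_ k G x) (lemT l c (by linarith) k G x)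
    push_cast at hj1 ⊢
    rw [abs_le] at hlr ⊢
    constructor <;> linarith [(Nat.cast_nonneg j : (0:ℝ) ≤ j)]
  refine (mul_le_mul_right (Finset.sum_le_sum hs) _).trans (le_of_eq ?_)
  rw [Finset.sum_const, Finset.card_range, nsmul_eq_mul]
  ring



def Kc (m : ℕ) : ℝ≥0∞ := 2 ^ m * (m * (2 * 2 ^ (m + 1)))

theorem Kc_top (m : ℕ) : Kc m ≠ ⊤ := by unfold Kc; finiteness

def Yd (I : Set ℝ) (m : ℕ) (f : ℝ → X) (k : ℤ) (x : ℝ) : ℝ≥0∞ :=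
  Pd I m f (k + (m + 1 : ℕ)) x + av (k + (m + 1 : ℕ)) (Pd I m f (k + (m + 1 : ℕ))) x

theorem Yd_meas {I : Set ℝ} (hI : MeasurableSet I) (m : ℕ) {f : ℝ → X} (hf : StronglyMeasurable f)
    (k : ℤ) : Measurable (Yd I m f k) :=
  (Pd_meas hI m hf _).add (av_meas _ (Pd_meas hI m hf _))

def Wd (I : Set ℝ) (m : ℕ) (f : ℝ → X) (t : ℝ) (x : ℝ) : ℝ≥0∞ :=
  ∫⁻ h in {h : ℝ | |h| < t ∧ x + (m : ℝ) * h ∈ I}, Ph m f x h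

theorem Wset_meas {I : Set ℝ} (hI : MeasurableSet I) (m : ℕ) (t x : ℝ) :
    MeasurableSet {h : ℝ | |h| < t ∧ x + (m : ℝ) * h ∈ I} := by
  refine MeasurableSet.inter (s₁ := {h : ℝ | |h| < t}) (measurableSet_lt (by fun_prop) (by fun_prop)) ?_
  exact (show Measurable fun h : ℝ => x + (m : ℝ) * h by fun_prop) hI

theorem Ph_meas1 (m : ℕ) {f : ℝ → X} (hf : StronglyMeasurable f) (x : ℝ) :
    Measurable fun h : ℝ => Ph m f x h :=
  (Ph_meas m hf).comp (f := fun h => (x, h)) (by fun_prop)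

theorem Pd_le_W {I : Set ℝ} (hIu : IsUpperSet I) (m : ℕ) (f : ℝ → X)
    (k : ℤ) {x : ℝ} (hx : x ∈ I) : Pd I m f k x ≤ Wd I m f (2 ^ k) x := by
  rw [Pd, indicator_of_mem hx, Wd]
  refine lintegral_mono_set ?_
  intro h hh
  refine ⟨by rw [abs_of_pos hh.1]; exact hh.2, hIu ?_ hx⟩
  have := hh.1
  have : 0 ≤ (m : ℝ) * h := by positivity
  linarith

theorem W_le {I : Set ℝ} (hI : MeasurableSet I) (hIu : IsUpperSet I) (m : ℕ) (hm : m ≠ 0)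
    {f : ℝ → X} (hf : StronglyMeasurable f) (k : ℤ) {x : ℝ} (hx : x ∈ I) :
    Wd I m f (2 ^ k) x ≤ Pd I m f k x + Kc m * Yd I m f k x := by
  set S := {h : ℝ | |h| < 2 ^ k ∧ x + (m : ℝ) * h ∈ I} with hS
  have hSm : MeasurableSet S := Wset_meas hI m _ x
  have hC := lemC hI hIu m hm (-m) (by simp) hf k x
  have h1 : S ⊆ (Ioo 0 (2 ^ k) ∪ {0}) ∪ (S ∩ Iio 0) := by
    intro h hh
    rcases lt_trichotomy h 0 with h0 | h0 | h0
    · right; exact ⟨hh, h0⟩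
    · left; right; exact h0
    · left; left; exact ⟨h0, (le_abs_self h).trans_lt hh.1⟩
  calc Wd I m f (2 ^ k) x ≤ ∫⁻ h in (Ioo 0 (2 ^ k) ∪ {0}) ∪ (S ∩ Iio 0), Ph m f x h := lintegral_mono_set h1
    _ ≤ ((∫⁻ h in Ioo 0 (2 ^ k), Ph m f x h) + ∫⁻ h in {0}, Ph m f x h) + ∫⁻ h in (S ∩ Iio 0), Ph m f x h :=
        (lintegral_union_le _ _ _).trans (add_le_add (lintegral_union_le _ _ _) le_rfl)
    _ ≤ Pd I m f k x + Kc m * Yd I m f k x := by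
        refine add_le_add ?_ (le_trans ?_ hC)
        · rw [Pd, indicator_of_mem hx]; simp
        · refine (le_of_eq ?_).trans (lint_change (-1) (by simp) 0 _ (S := S ∩ Iio 0) (hSm.inter measurableSet_Iio)
            measurableSet_Ioo ?_)
          · refine setLIntegral_congr_fun (hSm.inter measurableSet_Iio) ?_
            intro h hh
            have : x + ((-m : ℤ) : ℝ) * (0 + -1 * h) = x + m * h := by push_cast; ring
            simp only [this]
            rw [indicator_of_mem hh.1.2]
            have h2 := Ph_neg m f x (-h)
            rw [neg_neg] at h2
            rw [h2]
            congr 1 <;> ring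
          · intro h hh
            have h3 : h < 0 := hh.2
            have h4 := hh.1.1
            rw [abs_of_neg h3] at h4
            constructor <;> linarith

theorem dir1 {I : Set ℝ} (hI : MeasurableSet I) (hIu : IsUpperSet I) (m : ℕ) (hm : m ≠ 0)
    {f : ℝ → X} (hf : StronglyMeasurable f) (k : ℤ) (x : ℝ) :
    Pd I (m + 1) f k x ≤ Pd I m f k x + Kc m * Yd I m f k x := by
  by_cases hx : x ∈ I
  swap
  · rw [Pd, indicator_of_notMem hx]; exact bot_le
  have hC := lemC hI hIu m hm 1 (by simp; omega) hf k x
  rw [Pd, indicator_of_mem hx, Pd, indicator_of_mem hx]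
  refine (lintegral_mono fun h => Ph_succ m f x h).trans ?_
  rw [lintegral_add_right _ (Ph_meas1 m hf x), add_comm]
  refine add_le_add le_rfl (le_trans ?_ hC)
  refine setLIntegral_mono' measurableSet_Ioo fun h hh => ?_
  have : x + ((1 : ℤ) : ℝ) * h = x + h := by simp
  rw [this, indicator_of_mem (hIu (by linarith [hh.1]) hx)]

theorem dir2 {I : Set ℝ} (hI : MeasurableSet I) (hIu : IsUpperSet I) (m : ℕ)
    {f : ℝ → X} (hf : StronglyMeasurable f) (k : ℤ) (x : ℝ) :
    Pd I m f k x ≤ (2 ^ (m + 1))⁻¹ * Pd I m f (k + 1) x + (m * Kc (m + 1)) * Yd I (m + 1) f k x := by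
  by_cases hx : x ∈ I
  swap
  · rw [Pd, indicator_of_notMem hx]; exact bot_le
  have hC : ∀ j ∈ Finset.range m, ∫⁻ h in Ioo 0 ((2 : ℝ) ^ k), Ph (m + 1) f (x + j * h) h ≤
      Kc (m + 1) * Yd I (m + 1) f k x := by
    intro j hj
    have hj' : j < m := by simpa using hj
    refine le_trans ?_ (lemC hI hIu (m + 1) (by omega) j (by simp; omega) hf k x)
    refine setLIntegral_mono' measurableSet_Ioo fun h hh => ?_
    rw [indicator_of_mem]
    · simp
    · refine hIu ?_ hx
      have := hh.1
      have : 0 ≤ ((j : ℤ) : ℝ) * h := by positivity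
      linarith
  have hpm : ∀ j : ℕ, Measurable fun h : ℝ => Ph (m + 1) f (x + j * h) h := fun j =>
    (Ph_meas (m + 1) hf).comp (f := fun h => (x + j * h, h)) (by fun_prop)
  have hpm2 : Measurable fun h : ℝ => Ph m f x (2 * h) :=
    (Ph_meas m hf).comp (f := fun h => (x, 2 * h)) (by fun_prop)
  have h2 : ∫⁻ h in Ioo 0 ((2 : ℝ) ^ k), Ph m f x (2 * h) = 2⁻¹ * Pd I m f (k + 1) x := by
    rw [Pd, indicator_of_mem hx, ← lintegral_indicator measurableSet_Ioo, ← lintegral_indicator measurableSet_Ioo]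
    have := lint_affine 2 two_ne_zero 0 ((Ioo 0 ((2:ℝ) ^ (k+1))).indicator fun h => Ph m f x h)
    rw [show ENNReal.ofReal |(2:ℝ)⁻¹| = 2⁻¹ by rw [abs_of_pos (by norm_num), ENNReal.ofReal_inv_of_pos (by norm_num)]; simp] at this
    rw [← this]
    refine lintegral_congr fun h => ?_
    have hz : (2:ℝ) ^ (k + 1) = 2 * 2 ^ k := by rw [zpow_add_one₀ two_ne_zero, mul_comm]
    by_cases hh : h ∈ Ioo 0 ((2:ℝ)^k)
    · rw [indicator_of_mem hh, indicator_of_mem]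
      · simp
      · rw [hz]; constructor <;> linarith [hh.1, hh.2]
    · rw [indicator_of_notMem hh, indicator_of_notMem]
      rw [hz]; intro h4; apply hh; constructor <;> linarith [h4.1, h4.2]
  have e0 : (2 : ℝ≥0∞) ^ m ≠ 0 := by simp
  have et : (2 : ℝ≥0∞) ^ m ≠ ⊤ := by finiteness
  have key : 2 ^ m * Pd I m f k x ≤ 2⁻¹ * Pd I m f (k + 1) x + 2 ^ m * ((m * Kc (m + 1)) * Yd I (m + 1) f k x) := by
    nth_rewrite 1 [Pd]
    rw [indicator_of_mem hx, ← lintegral_const_mul' _ _ et]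
    refine (lintegral_mono fun h => Ph_marchaud m f x h).trans ?_
    rw [lintegral_add_left hpm2, h2, lintegral_const_mul' _ _ et,
      lintegral_finsetSum _ fun j _ => hpm j]
    refine add_le_add le_rfl (mul_le_mul_right ((Finset.sum_le_sum hC).trans (le_of_eq ?_)) _)
    rw [Finset.sum_const, Finset.card_range, nsmul_eq_mul, mul_assoc]
  rw [← ENNReal.mul_le_mul_iff_right e0 et]
  refine key.trans (le_of_eq ?_)
  rw [mul_add, ← mul_assoc (2 ^ m) ((2 ^ (m + 1))⁻¹)]
  congr 2
  rw [pow_succ, ENNReal.mul_inv (Or.inl e0) (Or.inl et), ← mul_assoc, ENNReal.mul_inv_cancel e0 et, one_mul]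

theorem Pd_growth {I : Set ℝ} (hI : MeasurableSet I) (hIu : IsUpperSet I) (m : ℕ)
    {f : ℝ → X} (hf : StronglyMeasurable f) (k : ℤ) (x : ℝ) :
    Pd I m f k x ≤ ENNReal.ofReal (2 ^ k) * ((2 ^ m * ((m + 1 : ℕ) * 2 ^ m)) *
      (I.indicator (fun y => ‖f y‖ₑ) x + Mx (I.indicator (fun y => ‖f y‖ₑ)) x)) := by
  by_cases hx : x ∈ I
  swap
  · rw [Pd, indicator_of_notMem hx]; exact bot_le
  set G := I.indicator (fun y => ‖f y‖ₑ) with hG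
  have hGm : Measurable G := hf.enorm.indicator hI
  have hGa : ∀ j : ℕ, Measurable fun h : ℝ => G (x + j * h) := fun j => hGm.comp (by fun_prop)
  have h1 : ∀ h ∈ Ioo 0 ((2:ℝ)^k), Ph m f x h ≤ 2 ^ m * ∑ j ∈ Finset.range (m + 1), G (x + j * h) := by
    intro h hh
    rw [Ph_eq, eD, Finset.mul_sum]
    refine (enorm_sum_le _ _).trans (Finset.sum_le_sum fun j _ => ?_)
    rw [enorm_smul, hG, indicator_of_mem]
    · exact mul_le_mul_left (cf_enorm _ _) _
    · refine hIu ?_ hx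
      have := hh.1
      have : 0 ≤ (j : ℝ) * h := by positivity
      linarith
  rw [Pd, indicator_of_mem hx]
  refine (setLIntegral_mono' measurableSet_Ioo h1).trans ?_
  rw [lintegral_const_mul' _ _ (by finiteness), lintegral_finsetSum _ fun j _ => hGa j]
  have h2 : ∀ j ∈ Finset.range (m + 1), ∫⁻ h in Ioo 0 ((2:ℝ)^k), G (x + j * h) ≤
      ENNReal.ofReal (2 ^ k) * (2 ^ m * (G x + Mx G x)) := by
    intro j hj
    have hj' : j < m + 1 := by simpa using hj
    have h3 := lemT j m (by
      have : j ≤ 2 ^ m := (by omega : j ≤ m).trans (Nat.lt_two_pow_self).le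
      rw [Int.cast_natCast, Nat.abs_cast]
      exact_mod_cast this) k G x
    simp only [Int.cast_natCast] at h3
    refine h3.trans ?_
    gcongr
    exact av_le_Mx _ _ _
  refine (mul_le_mul_right (Finset.sum_le_sum h2) _).trans (le_of_eq ?_)
  rw [Finset.sum_const, Finset.card_range, nsmul_eq_mul]
  ring



def sg (σ : ℝ) (k : ℤ) : ℝ≥0∞ := (2 : ℝ≥0∞) ^ (-(k : ℝ) * σ)

theorem two_rpow_top (a : ℝ) : (2 : ℝ≥0∞) ^ a ≠ ⊤ := by
  intro h; rw [ENNReal.rpow_eq_top_iff] at h; simp at h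

theorem two_rpow_zero (a : ℝ) : (2 : ℝ≥0∞) ^ a ≠ 0 := by
  intro h; rw [ENNReal.rpow_eq_zero_iff] at h; simp at h

theorem two_rpow_add (a b : ℝ) : (2 : ℝ≥0∞) ^ (a + b) = 2 ^ a * 2 ^ b :=
  ENNReal.rpow_add _ _ (by simp) (by simp)

theorem two_rpow_lt_one {a : ℝ} (ha : a < 0) : (2 : ℝ≥0∞) ^ a < 1 := by
  exact ENNReal.rpow_lt_one_of_one_lt_of_neg (by norm_num) ha

theorem ofReal_two_zpow (k : ℤ) : ENNReal.ofReal ((2 : ℝ) ^ k) = 2 ^ (k : ℝ) := by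
  rw [← Real.rpow_intCast, ← ENNReal.ofReal_rpow_of_pos (by norm_num)]
  simp

theorem sg_top (σ : ℝ) (k : ℤ) : sg σ k ≠ ⊤ := two_rpow_top _

theorem sg_shift (σ : ℝ) (k : ℤ) (c : ℕ) : sg σ k = 2 ^ ((c : ℝ) * σ) * sg σ (k + c) := by
  unfold sg
  rw [← two_rpow_add]; congr 1; push_cast; ring

theorem av_const (k : ℤ) (c : ℝ≥0∞) (hc : c ≠ ⊤) (u : ℝ → ℝ≥0∞) (x : ℝ) :
    av k (fun y => c * u y) x = c * av k u x := by
  unfold av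
  rw [lintegral_const_mul' _ _ hc]; ring

def Np (I : Set ℝ) (s p γ : ℝ) (q : ℝ≥0∞) (m : ℕ) (f : ℝ → X) : ℝ≥0∞ :=
  Nm γ p q (fun k x => sg (s + 1) k * Pd I m f k x)

theorem Y_bound (s p γ : ℝ) (q : ℝ≥0∞) (hp : 1 < p) (hγ : -1 < γ) (hγ2 : γ < p - 1) (hq : 1 ≤ q)
    (m : ℕ) : ∃ C : ℝ≥0∞, C ≠ ⊤ ∧ ∀ (I : Set ℝ) (f : ℝ → X), MeasurableSet I → StronglyMeasurable f →
      Nm γ p q (fun k x => sg (s + 1) k * Yd I m f k x) ≤ C * Np I s p γ q m f := by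
  obtain ⟨C, hC, hF⟩ := FS p γ q hp hγ hγ2 hq
  refine ⟨2 ^ (((m + 1 : ℕ) : ℝ) * (s + 1)) * (1 + C),
    ENNReal.mul_ne_top (two_rpow_top _) (by finiteness), fun I f hI hf => ?_⟩
  set g : ℤ → ℝ → ℝ≥0∞ := fun k x => sg (s + 1) k * Pd I m f k x with hg
  have hgm : ∀ k, Measurable (g k) := fun k => (Pd_meas hI m hf k).const_mul _
  set h : ℤ → ℝ → ℝ≥0∞ := fun k x => g k x + av k (g k) x with hh
  have e : (fun k x => sg (s + 1) k * Yd I m f k x) = fun k x => 2 ^ (((m + 1 : ℕ) : ℝ) * (s + 1)) *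
      (fun k x => h (k + (m + 1 : ℕ)) x) k x := by
    funext k x
    rw [sg_shift (s + 1) k (m + 1), mul_assoc]
    congr 1
    simp only [hh, hg, Yd]
    rw [av_const _ _ (sg_top _ _), mul_add]
  rw [e, Nm_mul γ p hp hq _ _ (two_rpow_top _), Nm_shift, mul_assoc]
  refine mul_le_mul_right ((Nm_add γ p hp hq hgm fun k => av_meas k (hgm k)).trans ?_) _
  rw [add_mul, one_mul]
  exact add_le_add le_rfl (hF g hgm)

theorem PY_bound (s p γ : ℝ) (q : ℝ≥0∞) (hp : 1 < p) (hγ : -1 < γ) (hγ2 : γ < p - 1) (hq : 1 ≤ q)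
    (m : ℕ) : ∃ C : ℝ≥0∞, C ≠ ⊤ ∧ ∀ (I : Set ℝ) (f : ℝ → X), MeasurableSet I → StronglyMeasurable f →
      Nm γ p q (fun k x => sg (s + 1) k * (Pd I m f k x + Kc m * Yd I m f k x)) ≤ C * Np I s p γ q m f := by
  obtain ⟨C, hC, hY⟩ := Y_bound (X := X) s p γ q hp hγ hγ2 hq m
  refine ⟨1 + Kc m * C, by have := Kc_top m; finiteness, fun I f hI hf => ?_⟩
  have e : (fun k x => sg (s + 1) k * (Pd I m f k x + Kc m * Yd I m f k x)) = fun k x =>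
      (fun k x => sg (s + 1) k * Pd I m f k x) k x + (fun k x => Kc m * (fun k x => sg (s + 1) k * Yd I m f k x) k x) k x := by
    funext k x
    simp only
    ring
  rw [e]
  refine (Nm_add γ p hp hq (fun k => (Pd_meas hI m hf k).const_mul _)
    (fun k => ((Yd_meas hI m hf k).const_mul _).const_mul _)).trans ?_
  rw [Nm_mul γ p hp hq _ _ (Kc_top m), add_mul, one_mul, mul_assoc]
  exact add_le_add le_rfl (mul_le_mul_right (hY I f hI hf) _)

theorem D1 (s p γ : ℝ) (q : ℝ≥0∞) (hp : 1 < p) (hγ : -1 < γ) (hγ2 : γ < p - 1) (hq : 1 ≤ q)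
    (m : ℕ) (hm : m ≠ 0) : ∃ C : ℝ≥0∞, C ≠ ⊤ ∧ ∀ (I : Set ℝ) (f : ℝ → X), MeasurableSet I → IsUpperSet I →
      StronglyMeasurable f → Np I s p γ q (m + 1) f ≤ C * Np I s p γ q m f := by
  obtain ⟨C, hC, h⟩ := PY_bound (X := X) s p γ q hp hγ hγ2 hq m
  refine ⟨C, hC, fun I f hI hIu hf => le_trans ?_ (h I f hI hf)⟩
  refine Nm_mono γ p hp hq (Filter.Eventually.of_forall fun x k => ?_)
  exact mul_le_mul_right (dir1 hI hIu m hm hf k x) _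

theorem iter_bound (a y : ℤ → ℝ≥0∞) (θ : ℝ≥0∞) (h : ∀ k, a k ≤ θ * a (k + 1) + y k)
    (hl : ∀ k : ℤ, Filter.Tendsto (fun n : ℕ => θ ^ n * a (k + n)) Filter.atTop (nhds 0)) (k : ℤ) :
    a k ≤ ∑' i : ℕ, θ ^ i * y (k + i) := by
  have h1 : ∀ n : ℕ, a k ≤ θ ^ n * a (k + n) + ∑ i ∈ Finset.range n, θ ^ i * y (k + i) := by
    intro n
    induction n with
    | zero => simp
    | succ n ih =>
      refine ih.trans ?_
      rw [Finset.sum_range_succ]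
      calc θ ^ n * a (k + n) + ∑ i ∈ Finset.range n, θ ^ i * y (k + i)
          ≤ θ ^ n * (θ * a (k + n + 1) + y (k + n)) + ∑ i ∈ Finset.range n, θ ^ i * y (k + i) := by
            gcongr; exact h _
        _ = _ := by push_cast; rw [← add_assoc k]; ring
  have h2 : ∀ n : ℕ, a k ≤ θ ^ n * a (k + n) + ∑' i : ℕ, θ ^ i * y (k + i) := fun n =>
    (h1 n).trans (add_le_add le_rfl (ENNReal.sum_le_tsum _))
  have h3 := (hl k).add_const (∑' i : ℕ, θ ^ i * y (k + i))
  rw [zero_add] at h3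
  exact ge_of_tendsto' h3 h2

theorem lpn_ae_lt_top {p γ : ℝ} (hp : 1 < p) {F : ℝ → ℝ≥0∞} (hF : Measurable F) (h : lpn (wm γ) p F ≠ ⊤) :
    ∀ᵐ x ∂(wm γ), F x ≠ ⊤ := by
  have hp0 : 0 < p := by linarith
  have h1 : ∫⁻ x, F x ^ p ∂(wm γ) ≠ ⊤ := by
    intro h2; apply h; rw [lpn, h2, ENNReal.top_rpow_of_pos (by positivity)]
  filter_upwards [ae_lt_top (hF.pow_const p) h1] with x hx hx2
  rw [hx2, ENNReal.top_rpow_of_pos hp0] at hx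
  exact lt_irrefl _ hx

theorem D2 (s p γ : ℝ) (q : ℝ≥0∞) (hs : 0 < s) (hp : 1 < p) (hγ : -1 < γ) (hγ2 : γ < p - 1) (hq : 1 ≤ q)
    (m : ℕ) (hm : s < m) : ∃ C : ℝ≥0∞, C ≠ ⊤ ∧ ∀ (I : Set ℝ) (f : ℝ → X), MeasurableSet I → IsUpperSet I →
      StronglyMeasurable f → lpn (wm γ) p (I.indicator fun y => ‖f y‖ₑ) ≠ ⊤ →
      Np I s p γ q m f ≤ C * Np I s p γ q (m + 1) f := by
  obtain ⟨C, hC, h⟩ := Y_bound (X := X) s p γ q hp hγ hγ2 hq (m + 1)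
  obtain ⟨C2, hC2, hM⟩ := Mx_strong p γ hp hγ hγ2
  set θ : ℝ≥0∞ := 2 ^ (s - m) with hθ
  have hθ1 : θ < 1 := two_rpow_lt_one (by linarith)
  set B : ℝ≥0∞ := m * Kc (m + 1) with hB
  have hBt : B ≠ ⊤ := ENNReal.mul_ne_top (by simp) (Kc_top _)
  refine ⟨(1 - θ)⁻¹ * (B * C), ENNReal.mul_ne_top ?_ (by finiteness), fun I f hI hIu hf hfin => ?_⟩
  · rw [ENNReal.inv_ne_top]; exact (tsub_pos_of_lt hθ1).ne'
  set G := I.indicator (fun y => ‖f y‖ₑ) with hG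
  have hGm : Measurable G := hf.enorm.indicator hI
  have hG1 := lpn_ae_lt_top hp hGm hfin
  have hG2 := lpn_ae_lt_top hp (Mx_meas hGm) (ne_top_of_le_ne_top (by finiteness) (hM G hGm))
  set y : ℤ → ℝ → ℝ≥0∞ := fun k x => sg (s + 1) k * Yd I (m + 1) f k x with hy
  have hym : ∀ k, Measurable (y k) := fun k => (Yd_meas hI (m + 1) hf k).const_mul _
  have hpt : ∀ᵐ x ∂(wm γ), ∀ k, sg (s + 1) k * Pd I m f k x ≤ ∑' i : ℕ, θ ^ i * (B * y (k + i) x) := by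
    filter_upwards [hG1, hG2] with x hx1 hx2
    refine iter_bound (fun k => sg (s + 1) k * Pd I m f k x) (fun k => B * y k x) θ ?_ ?_
    · intro k
      refine (mul_le_mul_right (dir2 hI hIu m hf k x) _).trans (le_of_eq ?_)
      rw [mul_add]
      congr 1
      · have := sg_shift (s + 1) k 1
        push_cast at this
        have hθe : θ = 2 ^ (s + 1) * (2 ^ (m + 1))⁻¹ := by
          rw [hθ, ← ENNReal.rpow_natCast, ← ENNReal.rpow_neg, ← two_rpow_add]
          congr 1; push_cast; ring
        rw [this, one_mul, hθe]
        ring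
      · simp only [hy, hB]; ring
    · intro k
      set D := ((2 ^ m * ((m + 1 : ℕ) * 2 ^ m)) * (G x + Mx G x)) with hD
      have hDt : D ≠ ⊤ := ENNReal.mul_ne_top (by finiteness) (by finiteness)
      have hb : ∀ n : ℕ, θ ^ n * (sg (s + 1) (k + n) * Pd I m f (k + n) x) ≤
          (2 ^ (-(k : ℝ) * s) * D) * ((2 : ℝ≥0∞) ^ (-(m : ℝ))) ^ n := by
        intro n
        calc θ ^ n * (sg (s + 1) (k + n) * Pd I m f (k + n) x)
            ≤ θ ^ n * (sg (s + 1) (k + n) * (2 ^ ((k + n : ℤ) : ℝ) * D)) := by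
              gcongr
              rw [← ofReal_two_zpow]
              exact Pd_growth hI hIu m hf (k + n) x
          _ = (θ ^ n * sg (s + 1) (k + n) * 2 ^ ((k + n : ℤ) : ℝ)) * D := by ring
          _ = (2 ^ (-(k : ℝ) * s) * ((2 : ℝ≥0∞) ^ (-(m : ℝ))) ^ n) * D := by
              congr 1
              rw [hθ, sg, ← ENNReal.rpow_natCast, ← ENNReal.rpow_natCast, ← ENNReal.rpow_mul,
                ← ENNReal.rpow_mul, ← two_rpow_add, ← two_rpow_add, ← two_rpow_add]
              congr 1; push_cast; ring
          _ = _ := by ring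
      have hm0 : (0:ℝ) < m := hs.trans hm
      have ht := ENNReal.Tendsto.const_mul (a := 2 ^ (-(k : ℝ) * s) * D)
        (ENNReal.tendsto_pow_atTop_nhds_zero_of_lt_one (two_rpow_lt_one (neg_lt_zero.2 hm0)))
        (Or.inr (ENNReal.mul_ne_top (two_rpow_top _) hDt))
      rw [mul_zero] at ht
      exact tendsto_of_tendsto_of_tendsto_of_le_of_le tendsto_const_nhds ht (fun n => bot_le) hb
  calc Np I s p γ q m f ≤ Nm γ p q (fun k x => ∑' i : ℕ, (fun (i : ℕ) (k : ℤ) x => θ ^ i * (B * y (k + i) x)) i k x) :=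
        Nm_mono γ p hp hq hpt
    _ ≤ ∑' i : ℕ, Nm γ p q (fun k x => θ ^ i * (B * y (k + i) x)) :=
        Nm_tsum γ p hp hq fun i k => ((hym _).const_mul _).const_mul _
    _ = ∑' i : ℕ, θ ^ i * (B * Nm γ p q y) := by
        refine tsum_congr fun i => ?_
        rw [Nm_mul γ p hp hq _ _ (by finiteness), Nm_mul γ p hp hq _ _ hBt]
        congr 2
        exact Nm_shift γ p q y i
    _ = (1 - θ)⁻¹ * (B * Nm γ p q y) := by
        rw [ENNReal.tsum_mul_right, ENNReal.tsum_geometric]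
    _ ≤ (1 - θ)⁻¹ * (B * (C * Np I s p γ q (m + 1) f)) := by
        gcongr
        exact h I f hI hf
    _ = _ := by ring



theorem Wd_mono (I : Set ℝ) (m : ℕ) (f : ℝ → X) (x : ℝ) {t u : ℝ} (h : t ≤ u) :
    Wd I m f t x ≤ Wd I m f u x :=
  lintegral_mono_set fun _ hh => ⟨hh.1.trans_le h, hh.2⟩

theorem dMean_eq (I : Set ℝ) (m : ℕ) (t : ℝ) (f : ℝ → X) (x : ℝ) :
    dMean I m t f x = ENNReal.ofReal t⁻¹ * Wd I m f t x := rfl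

theorem sg_eq (s : ℝ) (k : ℤ) :
    sg (s + 1) k = ENNReal.ofReal (((2 : ℝ) ^ k) ^ (-s)) * ENNReal.ofReal ((2 : ℝ) ^ k)⁻¹ := by
  have h2 : (0 : ℝ) < 2 ^ k := two_zpow_pos k
  rw [← ENNReal.ofReal_rpow_of_pos h2, ENNReal.ofReal_inv_of_pos h2, ofReal_two_zpow,
    ← ENNReal.rpow_mul, ← ENNReal.rpow_neg, ← two_rpow_add, sg]
  congr 1; ring

def En (I : Set ℝ) (s : ℝ) (m : ℕ) (f : ℝ → X) (x t : ℝ) : ℝ≥0∞ :=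
  ENNReal.ofReal (t ^ (-s)) * dMean I m t f x

theorem En_le (I : Set ℝ) (s : ℝ) (hs : 0 < s) (m : ℕ) (f : ℝ → X) (x t : ℝ) (k : ℤ)
    (ht : t ∈ Ico ((2 : ℝ) ^ k) (2 ^ (k + 1))) :
    En I s m f x t ≤ 2 ^ (s + 1) * (sg (s + 1) (k + 1) * Wd I m f (2 ^ (k + 1)) x) := by
  have h2 : (0 : ℝ) < 2 ^ k := two_zpow_pos k
  have ht0 : 0 < t := h2.trans_le ht.1
  have e := sg_shift (s + 1) k 1
  push_cast at e
  rw [one_mul] at e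
  rw [← mul_assoc, ← e, sg_eq, En, dMean_eq, ← mul_assoc]
  refine mul_le_mul' (mul_le_mul' (ENNReal.ofReal_le_ofReal ?_) (ENNReal.ofReal_le_ofReal ?_))
    (Wd_mono _ _ _ _ ht.2.le)
  · exact Real.rpow_le_rpow_of_nonpos h2 ht.1 (by linarith)
  · exact inv_anti₀ h2 ht.1

theorem le_En (I : Set ℝ) (s : ℝ) (hs : 0 < s) (m : ℕ) (f : ℝ → X) (x t : ℝ) (k : ℤ)
    (ht : t ∈ Ico ((2 : ℝ) ^ k) (2 ^ (k + 1))) :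
    sg (s + 1) k * Wd I m f (2 ^ k) x ≤ 2 ^ (s + 1) * En I s m f x t := by
  have h2 : (0 : ℝ) < 2 ^ k := two_zpow_pos k
  have ht0 : 0 < t := h2.trans_le ht.1
  have e := sg_shift (s + 1) k 1
  push_cast at e
  rw [one_mul] at e
  rw [e, mul_assoc, sg_eq, En, dMean_eq, ← mul_assoc (ENNReal.ofReal (t ^ (-s)))]
  refine mul_le_mul_right (mul_le_mul' (mul_le_mul' (ENNReal.ofReal_le_ofReal ?_) (ENNReal.ofReal_le_ofReal ?_))
    (Wd_mono _ _ _ _ ht.1)) _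
  · exact Real.rpow_le_rpow_of_nonpos ht0 ht.2.le (by linarith)
  · exact inv_anti₀ ht0 ht.2.le

theorem lint_dyadic (F : ℝ → ℝ≥0∞) :
    ∫⁻ t in Ioi (0 : ℝ), F t = ∑' k : ℤ, ∫⁻ t in Ico ((2 : ℝ) ^ k) (2 ^ (k + 1)), F t := by
  have e : Ioi (0 : ℝ) = ⋃ k : ℤ, Ico ((2 : ℝ) ^ k) (2 ^ (k + 1)) := by
    ext t
    simp only [mem_Ioi, mem_iUnion]
    constructor
    · intro h; exact exists_mem_Ico_zpow h one_lt_two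
    · rintro ⟨k, hk⟩; exact (two_zpow_pos k).trans_le hk.1
  have hd : Pairwise (Function.onFun Disjoint fun k : ℤ => Ico ((2 : ℝ) ^ k) (2 ^ (k + 1))) := by
    intro i j hij
    rw [Function.onFun, Set.disjoint_left]
    intro t h1 h2
    apply hij
    have a1 : i < j + 1 := (zpow_lt_zpow_iff_right₀ (one_lt_two (α := ℝ))).1 (h1.1.trans_lt h2.2)
    have a2 : j < i + 1 := (zpow_lt_zpow_iff_right₀ (one_lt_two (α := ℝ))).1 (h2.1.trans_lt h1.2)
    omega
  rw [e, lintegral_iUnion (fun _ => measurableSet_Ico) hd]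

theorem vol_dyadic (k : ℤ) : volume (Ico ((2 : ℝ) ^ k) (2 ^ (k + 1))) = ENNReal.ofReal (2 ^ k) := by
  rw [Real.volume_Ico]; congr 1
  rw [zpow_add₀ (by norm_num)]; norm_num; ring

theorem ofReal_z0 (k : ℤ) : ENNReal.ofReal ((2 : ℝ) ^ k) ≠ 0 := by
  rw [ofReal_two_zpow]; exact two_rpow_zero _

theorem innerQ_le (I : Set ℝ) (s : ℝ) (hs : 0 < s) (q : ℝ≥0∞) (hq : 1 ≤ q) (m : ℕ) (f : ℝ → X) (x : ℝ) :
    innerQ I s q m f x ≤ 2 ^ (s + 1) * lq q (fun k => sg (s + 1) k * Wd I m f (2 ^ k) x) := by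
  set b : ℤ → ℝ≥0∞ := fun k => sg (s + 1) k * Wd I m f (2 ^ k) x with hb
  by_cases hqt : q = ⊤
  · rw [innerQ, if_pos hqt]
    refine iSup₂_le fun t ht => ?_
    obtain ⟨k, hk⟩ := exists_mem_Ico_zpow ht (one_lt_two (α := ℝ))
    exact (En_le I s hs m f x t k hk).trans (mul_le_mul_right (le_lq hq b (k + 1)) _)
  · have hr := toReal_ge_one hq hqt
    have hr0 : 0 < q.toReal := by linarith
    rw [← lq_mul hq _ (two_rpow_top _), ← lq_shift q _ 1, innerQ, if_neg hqt, lq, if_neg hqt]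
    refine ENNReal.rpow_le_rpow ?_ (by positivity)
    rw [lint_dyadic]
    refine ENNReal.tsum_le_tsum fun k => ?_
    calc ∫⁻ t in Ico ((2 : ℝ) ^ k) (2 ^ (k + 1)), (En I s m f x t) ^ q.toReal * (ENNReal.ofReal t)⁻¹
        ≤ ∫⁻ t in Ico ((2 : ℝ) ^ k) (2 ^ (k + 1)),
            (2 ^ (s + 1) * b (k + 1)) ^ q.toReal * (ENNReal.ofReal (2 ^ k))⁻¹ := by
          refine setLIntegral_mono' measurableSet_Ico fun t ht => ?_
          refine mul_le_mul' (ENNReal.rpow_le_rpow (En_le I s hs m f x t k ht) hr0.le) ?_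
          exact ENNReal.inv_le_inv.2 (ENNReal.ofReal_le_ofReal ht.1)
      _ = (2 ^ (s + 1) * b (k + 1)) ^ q.toReal := by
          rw [setLIntegral_const, vol_dyadic, mul_assoc,
            ENNReal.inv_mul_cancel (ofReal_z0 k) ENNReal.ofReal_ne_top, mul_one]

theorem le_innerQ (I : Set ℝ) (s : ℝ) (hs : 0 < s) (q : ℝ≥0∞) (hq : 1 ≤ q) (m : ℕ) (f : ℝ → X) (x : ℝ) :
    lq q (fun k => sg (s + 1) k * Wd I m f (2 ^ k) x) ≤ 2 ^ (s + 1) * 2 * innerQ I s q m f x := by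
  by_cases hqt : q = ⊤
  · rw [lq, if_pos hqt, innerQ, if_pos hqt]
    refine iSup_le fun k => ?_
    have hk : (2 : ℝ) ^ k ∈ Ico ((2 : ℝ) ^ k) (2 ^ (k + 1)) :=
      ⟨le_rfl, zpow_lt_zpow_right₀ one_lt_two (by omega)⟩
    refine (le_En I s hs m f x _ k hk).trans ?_
    rw [mul_assoc]
    refine mul_le_mul_right ?_ _
    refine le_trans ?_ (le_mul_of_one_le_left' one_le_two)
    exact le_iSup₂ (f := fun (t : ℝ) (_ : 0 < t) => ENNReal.ofReal (t ^ (-s)) * dMean I m t f x)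
      ((2 : ℝ) ^ k) (two_zpow_pos k)
  · have hr := toReal_ge_one hq hqt
    have hr0 : 0 < q.toReal := by linarith
    rw [lq, if_neg hqt, rpow_one_div_le_iff' hr0, innerQ, if_neg hqt,
      ENNReal.mul_rpow_of_nonneg _ _ hr0.le, ← ENNReal.rpow_mul, one_div_mul_cancel hr0.ne',
      ENNReal.rpow_one, lint_dyadic, ← ENNReal.tsum_mul_left]
    refine ENNReal.tsum_le_tsum fun k => ?_
    set b := sg (s + 1) k * Wd I m f (2 ^ k) x with hb
    set A : ℝ≥0∞ := 2 ^ (s + 1) with hA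
    have hAt : A ≠ ⊤ := two_rpow_top _
    have h2 : (2 : ℝ≥0∞) ≤ 2 ^ q.toReal := by
      conv_lhs => rw [← ENNReal.rpow_one 2]
      exact ENNReal.rpow_le_rpow_of_exponent_le one_le_two hr
    have hz : ENNReal.ofReal ((2 : ℝ) ^ (k + 1)) = 2 * ENNReal.ofReal (2 ^ k) := by
      rw [zpow_add₀ (by norm_num), mul_comm, ENNReal.ofReal_mul (by norm_num)]; simp
    calc b ^ q.toReal = 2 * ∫⁻ t in Ico ((2 : ℝ) ^ k) (2 ^ (k + 1)),
            b ^ q.toReal * (ENNReal.ofReal (2 ^ (k + 1)))⁻¹ := by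
          rw [setLIntegral_const, vol_dyadic, hz, ENNReal.mul_inv (by simp) (by simp)]
          calc b ^ q.toReal = b ^ q.toReal * (2 * 2⁻¹) *
              ((ENNReal.ofReal (2 ^ k))⁻¹ * ENNReal.ofReal (2 ^ k)) := by
                rw [ENNReal.inv_mul_cancel (ofReal_z0 k) ENNReal.ofReal_ne_top,
                  ENNReal.mul_inv_cancel (by simp) (by simp)]; simp
            _ = _ := by ring
      _ ≤ 2 * ∫⁻ t in Ico ((2 : ℝ) ^ k) (2 ^ (k + 1)),
            A ^ q.toReal * ((En I s m f x t) ^ q.toReal * (ENNReal.ofReal t)⁻¹) := by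
          refine mul_le_mul_right (setLIntegral_mono' measurableSet_Ico fun t ht => ?_) _
          rw [← mul_assoc, ← ENNReal.mul_rpow_of_nonneg _ _ hr0.le]
          refine mul_le_mul' (ENNReal.rpow_le_rpow (le_En I s hs m f x t k ht) hr0.le) ?_
          exact ENNReal.inv_le_inv.2 (ENNReal.ofReal_le_ofReal ht.2.le)
      _ ≤ _ := by
          rw [lintegral_const_mul' _ _ (ENNReal.rpow_ne_top_of_nonneg hr0.le hAt), ← mul_assoc,
            ENNReal.mul_rpow_of_nonneg _ _ hr0.le, mul_comm (2 : ℝ≥0∞)]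
          exact mul_le_mul_left (mul_le_mul_right h2 _) _

theorem diffSeminorm_eq {I : Set ℝ} (hI : MeasurableSet I) (s p γ : ℝ) (q : ℝ≥0∞) (m : ℕ) (f : ℝ → X) :
    diffSeminorm I s p γ q m f = lpn ((wm γ).restrict I) p (innerQ I s q m f) := by
  rw [lpn, setLint_wm _ _ hI]; rfl

theorem wLpNorm_eq {I : Set ℝ} (hI : MeasurableSet I) (p γ : ℝ) (hp : 1 < p) (f : ℝ → X) :
    wLpNorm I p γ f = lpn (wm γ) p (I.indicator fun y => ‖f y‖ₑ) := by
  have e : (fun x => (I.indicator (fun y => ‖f y‖ₑ) x) ^ p) = I.indicator fun y => ‖f y‖ₑ ^ p := by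
    funext x
    by_cases hx : x ∈ I
    · simp [hx]
    · simp [hx, show 0 < p by linarith]
  rw [lpn, e, lintegral_indicator hI, setLint_wm _ _ hI]; rfl

theorem Np_le {I : Set ℝ} (hI : MeasurableSet I) (hIu : IsUpperSet I) (s p γ : ℝ) (q : ℝ≥0∞) (hs : 0 < s)
    (hp : 1 < p) (hq : 1 ≤ q) (m : ℕ) (f : ℝ → X) :
    Np I s p γ q m f ≤ 2 ^ (s + 1) * 2 * diffSeminorm I s p γ q m f := by
  have hp0 : 0 < p := by linarith
  rw [diffSeminorm_eq hI, ← lpn_mul _ _ hp0 _ (ENNReal.mul_ne_top (two_rpow_top _) (by simp)), Np, Nm]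
  unfold lpn
  refine ENNReal.rpow_le_rpow ?_ (by positivity)
  rw [← lintegral_indicator hI]
  refine lintegral_mono fun x => ?_
  by_cases hx : x ∈ I
  · rw [indicator_of_mem hx]
    refine ENNReal.rpow_le_rpow (le_trans (lq_mono hq fun k => ?_) (le_innerQ I s hs q hq m f x)) hp0.le
    exact mul_le_mul_right (Pd_le_W hIu m f k hx) _
  · rw [indicator_of_notMem hx]
    have : lq q (fun k => sg (s + 1) k * Pd I m f k x) ≤ 0 := by
      calc _ = lq q (fun k => 0 * (0 : ℝ≥0∞)) := by simp [Pd, hx]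
        _ = 0 := by rw [lq_mul hq 0 (by simp) (fun _ => 0)]; simp
        _ ≤ 0 := le_rfl
    rw [nonpos_iff_eq_zero] at this
    simp only [this]
    rw [ENNReal.zero_rpow_of_pos hp0]

theorem le_Np (s p γ : ℝ) (q : ℝ≥0∞) (hs : 0 < s) (hp : 1 < p) (hγ : -1 < γ) (hγ2 : γ < p - 1) (hq : 1 ≤ q)
    (m : ℕ) (hm : m ≠ 0) : ∃ C : ℝ≥0∞, C ≠ ⊤ ∧ ∀ (I : Set ℝ) (f : ℝ → X), MeasurableSet I → IsUpperSet I →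
      StronglyMeasurable f → diffSeminorm I s p γ q m f ≤ C * Np I s p γ q m f := by
  have hp0 : 0 < p := by linarith
  obtain ⟨C, hC, h⟩ := PY_bound (X := X) s p γ q hp hγ hγ2 hq m
  refine ⟨2 ^ (s + 1) * C, ENNReal.mul_ne_top (two_rpow_top _) hC, fun I f hI hIu hf => ?_⟩
  rw [mul_assoc]
  refine le_trans ?_ (mul_le_mul_right (h I f hI hf) _)
  rw [diffSeminorm_eq hI, Nm, ← lpn_mul _ _ hp0 _ (two_rpow_top _)]
  unfold lpn
  refine ENNReal.rpow_le_rpow ?_ (by positivity)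
  refine le_trans ?_ (setLIntegral_le_lintegral I _)
  refine setLIntegral_mono' hI fun x hx => ENNReal.rpow_le_rpow ?_ hp0.le
  refine (innerQ_le I s hs q hq m f x).trans (mul_le_mul_right (lq_mono hq fun k => ?_) _)
  exact mul_le_mul_right (W_le hI hIu m hm hf k hx) _

def Eqv (s p γ : ℝ) (q : ℝ≥0∞) (I : Set ℝ) (X : Type*) [NormedAddCommGroup X] [NormedSpace ℝ X] (m n : ℕ) : Prop :=
  ∃ C : ℝ≥0∞, C ≠ ⊤ ∧ ∀ f : ℝ → X, StronglyMeasurable f → lpn (wm γ) p (I.indicator fun y => ‖f y‖ₑ) ≠ ⊤ →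
    Np I s p γ q m f ≤ C * Np I s p γ q n f ∧ Np I s p γ q n f ≤ C * Np I s p γ q m f

theorem Eqv_add (s p γ : ℝ) (q : ℝ≥0∞) (hs : 0 < s) (hp : 1 < p) (hγ : -1 < γ) (hγ2 : γ < p - 1) (hq : 1 ≤ q)
    {I : Set ℝ} (hI : MeasurableSet I) (hIu : IsUpperSet I) (m : ℕ) (hm : s < m) (d : ℕ) :
    Eqv s p γ q I X m (m + d) := by
  induction d with
  | zero => exact ⟨1, by simp, fun f _ _ => by simp⟩
  | succ d ih =>
    obtain ⟨C, hC, h⟩ := ih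
    have hmd : s < ((m + d : ℕ) : ℝ) := hm.trans_le (by push_cast; linarith [(Nat.cast_nonneg d : (0:ℝ) ≤ d)])
    have h0 : m + d ≠ 0 := by
      intro h0; rw [h0] at hmd; simp at hmd; linarith
    obtain ⟨C1, hC1, h1⟩ := D1 (X := X) s p γ q hp hγ hγ2 hq (m + d) h0
    obtain ⟨C2, hC2, h2⟩ := D2 (X := X) s p γ q hs hp hγ hγ2 hq (m + d) hmd
    refine ⟨C * C2 + C1 * C, by finiteness, fun f hf hfin => ⟨?_, ?_⟩⟩
    · refine ((h f hf hfin).1.trans (mul_le_mul_right (h2 I f hI hIu hf hfin) _)).trans ?_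
      rw [← mul_assoc]
      exact mul_le_mul_left le_self_add _
    · refine ((h1 I f hI hIu hf).trans (mul_le_mul_right (h f hf hfin).2 _)).trans ?_
      rw [← mul_assoc]
      exact mul_le_mul_left le_add_self _

theorem Eqv_all (s p γ : ℝ) (q : ℝ≥0∞) (hs : 0 < s) (hp : 1 < p) (hγ : -1 < γ) (hγ2 : γ < p - 1) (hq : 1 ≤ q)
    {I : Set ℝ} (hI : MeasurableSet I) (hIu : IsUpperSet I) (m n : ℕ) (hm : s < m) (hn : s < n) :
    Eqv s p γ q I X m n := by
  rcases le_total m n with h | h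
  · obtain ⟨d, rfl⟩ := Nat.exists_eq_add_of_le h
    exact Eqv_add s p γ q hs hp hγ hγ2 hq hI hIu m hm d
  · obtain ⟨d, rfl⟩ := Nat.exists_eq_add_of_le h
    obtain ⟨C, hC, h⟩ := Eqv_add (X := X) s p γ q hs hp hγ hγ2 hq hI hIu n hn d
    exact ⟨C, hC, fun f hf hfin => (h f hf hfin).symm⟩

theorem ae_affine (a : ℝ) (ha : a ≠ 0) (x : ℝ) {P : ℝ → Prop} (h : ∀ᵐ y, P y) : ∀ᵐ r : ℝ, P (x + a * r) := by
  rw [ae_iff] at h ⊢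
  have e : {r : ℝ | ¬ P (x + a * r)} = (a * ·) ⁻¹' ((x + ·) ⁻¹' {y | ¬ P y}) := rfl
  rw [e, Real.volume_preimage_mul_left ha, measure_preimage_add, h, mul_zero]

theorem Wd_congr {I : Set ℝ} (hI : MeasurableSet I) (hIu : IsUpperSet I) (m : ℕ) {f g : ℝ → X}
    (h : ∀ᵐ y, y ∈ I → f y = g y) {x : ℝ} (hx : x ∈ I) (hfx : f x = g x) (t : ℝ) :
    Wd I m f t x = Wd I m g t x := by
  unfold Wd
  refine setLIntegral_congr_fun_ae (Wset_meas hI m t x) ?_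
  have h1 : ∀ᵐ r : ℝ, ∀ j : ℕ, j ≠ m → x + ((m : ℝ) - j) * r ∈ I →
      f (x + ((m : ℝ) - j) * r) = g (x + ((m : ℝ) - j) * r) := by
    rw [ae_all_iff]
    intro j
    by_cases hj : j = m
    · simp [hj]
    · filter_upwards [ae_affine ((m : ℝ) - j) (sub_ne_zero.2 (by exact_mod_cast Ne.symm hj)) x h] with r hr _ using hr
  filter_upwards [h1] with r hr hrS
  rw [Ph, Ph]
  congr 1
  unfold mDiff
  refine Finset.sum_congr rfl fun j hj => ?_
  have hjm : j ≤ m := by simpa [Nat.lt_succ_iff] using hj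
  congr 1
  by_cases hj2 : j = m
  · subst hj2; simpa using hfx
  · refine hr j hj2 ?_
    have hc : (0 : ℝ) ≤ (m : ℝ) - j := sub_nonneg.2 (by exact_mod_cast hjm)
    have hj0 : (0 : ℝ) ≤ j := Nat.cast_nonneg j
    rcases le_total 0 r with h0 | h0
    · exact hIu (show x ≤ _ by nlinarith) hx
    · exact hIu (show x + (m : ℝ) * r ≤ _ by nlinarith) hrS.2

theorem diff_congr {I : Set ℝ} (hI : MeasurableSet I) (hIu : IsUpperSet I) (s p γ : ℝ) (q : ℝ≥0∞) (m : ℕ)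
    {f g : ℝ → X} (h : f =ᵐ[volume.restrict I] g) :
    diffSeminorm I s p γ q m f = diffSeminorm I s p γ q m g := by
  have h' : ∀ᵐ y, y ∈ I → f y = g y := (ae_restrict_iff' hI).1 h
  unfold diffSeminorm
  congr 1
  refine setLIntegral_congr_fun_ae hI ?_
  filter_upwards [h'] with x hx hxI
  have e : ∀ t, dMean I m t f x = dMean I m t g x := fun t => by
    rw [dMean_eq, dMean_eq, Wd_congr hI hIu m h' hxI (hx hxI)]
  unfold innerQ
  simp_rw [e]

theorem wLp_congr {I : Set ℝ} (p γ : ℝ)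
    {f g : ℝ → X} (h : f =ᵐ[volume.restrict I] g) : wLpNorm I p γ f = wLpNorm I p γ g := by
  unfold wLpNorm
  congr 1
  refine lintegral_congr_ae ?_
  filter_upwards [h] with x hx
  rw [hx]

theorem main_half (s p γ : ℝ) (q : ℝ≥0∞) (m n : ℕ)
    (hs : 0 < s) (hp : 1 < p) (hγ₁ : -1 < γ) (hγ₂ : γ < p - 1) (hq : 1 ≤ q)
    (hm : s < m) (hn : s < n) {I : Set ℝ} (hI : MeasurableSet I) (hIu : IsUpperSet I) :
    ∃ C : ℝ≥0∞, C ≠ ⊤ ∧ ∀ f : ℝ → X,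
      AEStronglyMeasurable f (volume.restrict I) → wLpNorm I p γ f < ⊤ →
        diffSeminorm I s p γ q m f ≤ C * diffSeminorm I s p γ q n f := by
  obtain ⟨C1, hC1, h1⟩ := le_Np (X := X) s p γ q hs hp hγ₁ hγ₂ hq m
    (by rintro rfl; simp at hm; linarith)
  obtain ⟨C2, hC2, h2⟩ := Eqv_all (X := X) s p γ q hs hp hγ₁ hγ₂ hq hI hIu m n hm hn
  refine ⟨C1 * (C2 * (2 ^ (s + 1) * 2)), ?_, fun f hf hfin => ?_⟩
  · have := two_rpow_top (s + 1)
    finiteness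
  have hg : StronglyMeasurable (hf.mk f) := hf.stronglyMeasurable_mk
  have hfg := hf.ae_eq_mk
  set g := hf.mk f
  rw [wLp_congr p γ hfg, wLpNorm_eq hI p γ hp] at hfin
  rw [diff_congr hI hIu s p γ q m hfg, diff_congr hI hIu s p γ q n hfg]
  calc _ ≤ C1 * Np I s p γ q m g := h1 I g hI hIu hg
    _ ≤ C1 * (C2 * Np I s p γ q n g) := mul_le_mul_right (h2 g hg hfin.ne).1 _
    _ ≤ C1 * (C2 * (2 ^ (s + 1) * 2 * diffSeminorm I s p γ q n g)) :=
        mul_le_mul_right (mul_le_mul_right (Np_le hI hIu s p γ q hs hp hq n g) _) _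
    _ = _ := by ring

theorem order_equiv_aux
    (s p γ : ℝ) (q : ℝ≥0∞) (m n : ℕ)
    (hs : 0 < s) (hp : 1 < p) (hγ₁ : -1 < γ) (hγ₂ : γ < p - 1) (hq : 1 ≤ q)
    (hm : s < m) (hn : s < n)
    (I : Set ℝ) (hI : I = univ ∨ I = Ioi (0:ℝ)) :
    ∃ C : ℝ≥0∞, C ≠ ⊤ ∧ ∀ f : ℝ → X,
      AEStronglyMeasurable f (volume.restrict I) → wLpNorm I p γ f < ⊤ →
        diffSeminorm I s p γ q m f ≤ C * diffSeminorm I s p γ q n f ∧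
        diffSeminorm I s p γ q n f ≤ C * diffSeminorm I s p γ q m f := by
  have hIm : MeasurableSet I := by rcases hI with rfl | rfl <;> measurability
  have hIu : IsUpperSet I := by
    rcases hI with rfl | rfl
    · exact isUpperSet_univ
    · exact isUpperSet_Ioi 0
  obtain ⟨C1, hC1, h1⟩ := main_half (X := X) s p γ q m n hs hp hγ₁ hγ₂ hq hm hn hIm hIu
  obtain ⟨C2, hC2, h2⟩ := main_half (X := X) s p γ q n m hs hp hγ₁ hγ₂ hq hn hm hIm hIu
  refine ⟨C1 + C2, by finiteness, fun f hf hfin => ⟨?_, ?_⟩⟩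
  · exact (h1 f hf hfin).trans (mul_le_mul_left le_self_add _)
  · exact (h2 f hf hfin).trans (mul_le_mul_left le_add_self _)


/-- For `s > 0`, `p ∈ (1,∞)`, `γ ∈ (-1, p-1)`, `q ∈ [1,∞]` and integers `m, n > s`,
the difference seminorms of orders `m` and `n` are equivalent on
`F^s_{p,q}(I, w_γ; X)`, for `I ∈ {ℝ, (0,∞)}`. -/
theorem diffSeminorm_order_equiv
    (s p γ : ℝ) (q : ℝ≥0∞) (m n : ℕ)
    (hs : 0 < s) (hp : 1 < p) (hγ₁ : -1 < γ) (hγ₂ : γ < p - 1) (hq : 1 ≤ q)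
    (hm : s < m) (hn : s < n)
    (I : Set ℝ) (hI : I = univ ∨ I = Ioi (0:ℝ)) :
    ∃ C : ℝ≥0∞, C ≠ ⊤ ∧ ∀ f : ℝ → X,
      AEStronglyMeasurable f (volume.restrict I) → wLpNorm I p γ f < ⊤ →
        diffSeminorm I s p γ q m f ≤ C * diffSeminorm I s p γ q n f ∧
        diffSeminorm I s p γ q n f ≤ C * diffSeminorm I s p γ q m f := by
  exact order_equiv_aux s p γ q m n hs hp hγ₁ hγ₂ hq hm hn I hI
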